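/- arXiv:1810.04870 — 8 statements merged into one kernel-verified Lean document; each statement's English description precedes it below -/
import Mathlib

section
/- Let G be a connected simple graph on n vertices. Then the path spectral radius satisfies ρ(G) ≥ n − 1, with equality if and only if G is a tree (i.e., G is connected and acyclic). -/
open SimpleGraph Polynomial

/-- Two walks from `u` to `v` are *internally disjoint* if their supports
meet only in the endpoints `u` and `v`. -/
def InternallyDisjoint {V : Type*} {G : SimpleGraph V} {u v : V}
    (p q : G.Walk u v) : Prop :=
  ∀ w, w ∈ p.support → w ∈ q.support → w = u ∨ w = v

/-- The maximum number of pairwise internally vertex-disjoint paths from `u` to `v`. -/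
noncomputable def maxDisjointPaths {V : Type*} (G : SimpleGraph V) (u v : V) : ℕ :=
  sSup {m : ℕ | ∃ f : Fin m → G.Path u v, Function.Injective f ∧
    ∀ i j, i ≠ j → InternallyDisjoint (f i).1 (f j).1}

/-- The path matrix of a graph on `Fin n`. -/
noncomputable def pathMatrix {n : ℕ} (G : SimpleGraph (Fin n)) :
    Matrix (Fin n) (Fin n) ℝ :=
  Matrix.of fun i j => if i = j then 0 else (maxDisjointPaths G i j : ℝ)

/-- The path energy: sum of the absolute values of the eigenvalues of the path matrix
(the roots, with multiplicity, of its characteristic polynomial). -/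
noncomputable def pathEnergy {n : ℕ} (G : SimpleGraph (Fin n)) : ℝ :=
  ((pathMatrix G).charpoly.roots.map (fun x => |x|)).sum

/-- The path spectral radius: the largest eigenvalue of the path matrix. -/
noncomputable def pathSpectralRadius {n : ℕ} (G : SimpleGraph (Fin n)) : ℝ :=
  sSup {x : ℝ | (pathMatrix G).charpoly.IsRoot x}

section MaxDisjointPaths

variable {V : Type*} {G : SimpleGraph V} {u v : V}

lemma InternallyDisjoint.symm {p q : G.Walk u v} (h : InternallyDisjoint p q) :
    InternallyDisjoint q p :=
  fun w hq hp => h w hp hq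

lemma InternallyDisjoint.reverse {p q : G.Walk u v} (h : InternallyDisjoint p q) :
    InternallyDisjoint p.reverse q.reverse := by
  intro w hp hq
  rw [Walk.support_reverse, List.mem_reverse] at hp hq
  exact (h w hp hq).symm

lemma bddAbove_card_disjointPaths [Finite V] (G : SimpleGraph V) (u v : V) :
    BddAbove {m : ℕ | ∃ f : Fin m → G.Path u v, Function.Injective f ∧
      ∀ i j, i ≠ j → InternallyDisjoint (f i).1 (f j).1} := by
  classical
  have := Fintype.ofFinite V
  refine ⟨Fintype.card (G.Path u v), ?_⟩
  rintro m ⟨f, hf, -⟩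
  simpa using Fintype.card_le_of_injective f hf

lemma maxDisjointPaths_comm (G : SimpleGraph V) (u v : V) :
    maxDisjointPaths G u v = maxDisjointPaths G v u := by
  have key : ∀ a b : V, ∀ m : ℕ,
      (∃ f : Fin m → G.Path a b, Function.Injective f ∧
        ∀ i j, i ≠ j → InternallyDisjoint (f i).1 (f j).1) →
      ∃ f : Fin m → G.Path b a, Function.Injective f ∧
        ∀ i j, i ≠ j → InternallyDisjoint (f i).1 (f j).1 := by
    rintro a b m ⟨f, hf, hd⟩
    refine ⟨fun i => (f i).reverse, fun i j hij => hf (Subtype.ext ?_),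
      fun i j hij => (hd i j hij).reverse⟩
    exact Walk.reverse_injective (congrArg Subtype.val hij)
  unfold maxDisjointPaths
  congr 1
  ext m
  exact ⟨key u v m, key v u m⟩

lemma one_le_maxDisjointPaths [Finite V] (h : G.Reachable u v) :
    1 ≤ maxDisjointPaths G u v := by
  classical
  obtain ⟨p⟩ := h
  exact le_csSup (bddAbove_card_disjointPaths G u v)
    ⟨fun _ => p.toPath, Function.injective_of_subsingleton _,
      fun i j hij => absurd (Subsingleton.elim i j) hij⟩

lemma two_le_maxDisjointPaths [Finite V] {p q : G.Path u v} (hpq : p ≠ q)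
    (hd : InternallyDisjoint p.1 q.1) : 2 ≤ maxDisjointPaths G u v := by
  refine le_csSup (bddAbove_card_disjointPaths G u v) ⟨![p, q], ?_, ?_⟩
  · intro i j hij
    fin_cases i <;> fin_cases j <;> simp_all [eq_comm]
  · intro i j hij
    fin_cases i <;> fin_cases j <;> first | exact absurd rfl hij | exact hd | exact hd.symm

lemma two_le_maxDisjointPaths_of_not_isBridge [Finite V] (h : G.Adj u v)
    (hb : ¬ G.IsBridge s(u, v)) : 2 ≤ maxDisjointPaths G u v := by
  classical
  rw [isBridge_iff_forall_walk_mem_edges] at hb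
  push Not at hb
  obtain ⟨p, hp⟩ := hb
  refine two_le_maxDisjointPaths (p := Path.singleton h) (q := p.toPath) ?_ ?_
  · intro heq
    refine hp (p.edges_bypass_subset_edges ?_)
    change s(u, v) ∈ (p.toPath : G.Walk u v).edges
    rw [← heq]
    simp [Path.singleton]
  · intro w hw _
    simpa [Path.singleton] using hw

lemma SimpleGraph.IsAcyclic.maxDisjointPaths_le_one (hG : G.IsAcyclic) (u v : V) :
    maxDisjointPaths G u v ≤ 1 := by
  refine csSup_le ⟨0, Fin.elim0, Function.injective_of_subsingleton _, fun i => i.elim0⟩ ?_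
  rintro m ⟨f, hf, -⟩
  by_contra! hm
  have := hf ((hG.subsingleton_path u v).elim (f ⟨0, by omega⟩) (f ⟨1, hm⟩))
  simp at this

lemma SimpleGraph.isAcyclic_of_maxDisjointPaths_le_one [Finite V]
    (h : ∀ u v, u ≠ v → maxDisjointPaths G u v ≤ 1) : G.IsAcyclic := by
  rw [isAcyclic_iff_forall_adj_isBridge]
  intro u v huv
  by_contra hb
  have h₁ := h u v huv.ne
  have h₂ := two_le_maxDisjointPaths_of_not_isBridge huv hb
  omega

end MaxDisjointPaths

section CharpolyRoots

variable {ι : Type*} [Fintype ι] [DecidableEq ι] {A : Matrix ι ι ℝ}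

lemma Matrix.isRoot_charpoly_iff_exists_mulVec_eq {x : ℝ} :
    A.charpoly.IsRoot x ↔ ∃ v ≠ 0, A.mulVec v = x • v := by
  rw [IsRoot.def, Matrix.eval_charpoly, ← Matrix.exists_mulVec_eq_zero_iff]
  refine exists_congr fun v => and_congr_right fun _ => ?_
  rw [Matrix.sub_mulVec, sub_eq_zero, eq_comm, Matrix.scalar_apply,
    ← Matrix.smul_one_eq_diagonal, Matrix.smul_mulVec, Matrix.one_mulVec]

lemma Matrix.finite_setOf_isRoot_charpoly (A : Matrix ι ι ℝ) :
    {x : ℝ | A.charpoly.IsRoot x}.Finite :=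
  Polynomial.finite_setOfPred_isRoot A.charpoly_monic.ne_zero

lemma Matrix.IsHermitian.posSemidef_smul_one_sub (hA : A.IsHermitian) {r : ℝ}
    (hr : ∀ x, A.charpoly.IsRoot x → x ≤ r) :
    (r • (1 : Matrix ι ι ℝ) - A).PosSemidef := by
  have hB : (r • (1 : Matrix ι ι ℝ) - A).IsHermitian := by
    refine Matrix.IsHermitian.sub ?_ hA
    simp [Matrix.IsHermitian]
  rw [hB.posSemidef_iff_eigenvalues_nonneg]
  intro i
  have hv := hB.mulVec_eigenvectorBasis i
  rw [Matrix.sub_mulVec, Matrix.smul_mulVec, Matrix.one_mulVec] at hv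
  have hroot : A.charpoly.IsRoot (r - hB.eigenvalues i) := by
    refine Matrix.isRoot_charpoly_iff_exists_mulVec_eq.2
      ⟨⇑(hB.eigenvectorBasis i), fun h0 => ?_, ?_⟩
    · refine hB.eigenvectorBasis.orthonormal.ne_zero i ?_
      ext j
      exact congrFun h0 j
    · rw [sub_smul, ← hv, sub_sub_cancel]
  have := hr _ hroot
  simp only [Pi.zero_apply]
  linarith

lemma Matrix.IsHermitian.sum_entries_le_mul_card (hA : A.IsHermitian) {r : ℝ}
    (hr : ∀ x, A.charpoly.IsRoot x → x ≤ r) :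
    ∑ i, ∑ j, A i j ≤ r * Fintype.card ι := by
  have h := (hA.posSemidef_smul_one_sub hr).dotProduct_mulVec_nonneg (fun _ => 1)
  rw [Matrix.sub_mulVec, Matrix.smul_mulVec, Matrix.one_mulVec] at h
  simp only [dotProduct, Matrix.mulVec, Finset.sum_sub_distrib, Pi.sub_apply, Pi.smul_apply,
    Pi.star_apply, star_trivial, smul_eq_mul, mul_one, one_mul, Finset.sum_const, Finset.card_univ,
    nsmul_eq_mul] at h
  linarith

lemma Matrix.exists_le_sum_of_isRoot_charpoly {x : ℝ} (hx : A.charpoly.IsRoot x) :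
    ∃ k, |x - A k k| ≤ ∑ j ∈ Finset.univ.erase k, |A k j| := by
  obtain ⟨v, hv, h⟩ := Matrix.isRoot_charpoly_iff_exists_mulVec_eq.1 hx
  have hev : Module.End.HasEigenvalue (Matrix.toLin' A) x :=
    Module.End.hasEigenvalue_of_hasEigenvector
      ⟨Module.End.mem_eigenspace_iff.2 (by simpa using h), hv⟩
  obtain ⟨k, hk⟩ := eigenvalue_mem_ball hev
  exact ⟨k, by simpa [Real.dist_eq] using hk⟩

end CharpolyRoots

section PathMatrix

variable {n : ℕ} {G : SimpleGraph (Fin n)}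

lemma pathMatrix_apply_self (i : Fin n) : pathMatrix G i i = 0 := by
  simp [pathMatrix]

lemma pathMatrix_apply_of_ne {i j : Fin n} (h : i ≠ j) :
    pathMatrix G i j = maxDisjointPaths G i j := by
  simp [pathMatrix, h]

lemma isHermitian_pathMatrix (G : SimpleGraph (Fin n)) : (pathMatrix G).IsHermitian := by
  ext i j
  simp [pathMatrix, maxDisjointPaths_comm G j i, eq_comm]

lemma le_pathSpectralRadius {x : ℝ} (hx : (pathMatrix G).charpoly.IsRoot x) :
    x ≤ pathSpectralRadius G :=
  le_csSup (Matrix.finite_setOf_isRoot_charpoly _).bddAbove hx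

lemma sum_pathMatrix_le (G : SimpleGraph (Fin n)) :
    ∑ i, ∑ j, pathMatrix G i j ≤ pathSpectralRadius G * n := by
  simpa using (isHermitian_pathMatrix G).sum_entries_le_mul_card
    fun _ => le_pathSpectralRadius

lemma sum_ite_eq_zero_one (n : ℕ) :
    ∑ i : Fin n, ∑ j : Fin n, (if i = j then (0 : ℝ) else 1) = ((n : ℝ) - 1) * n := by
  have h (i j : Fin n) : (if i = j then (0 : ℝ) else 1) = 1 - if i = j then 1 else 0 := by
    split_ifs <;> simp
  simp only [h, Finset.sum_sub_distrib]
  simp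
  ring

lemma SimpleGraph.Connected.ite_le_pathMatrix (hG : G.Connected) (i j : Fin n) :
    (if i = j then (0 : ℝ) else 1) ≤ pathMatrix G i j := by
  split_ifs with h
  · rw [h, pathMatrix_apply_self]
  · rw [pathMatrix_apply_of_ne h]
    exact_mod_cast one_le_maxDisjointPaths (hG.preconnected i j)

lemma SimpleGraph.Connected.sub_one_le_pathSpectralRadius (hG : G.Connected) :
    (n : ℝ) - 1 ≤ pathSpectralRadius G := by
  have := hG.nonempty
  have hn : (0 : ℝ) < n := by exact_mod_cast Fin.pos_iff_nonempty.2 this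
  refine le_of_mul_le_mul_right ?_ hn
  rw [← sum_ite_eq_zero_one]
  exact (Finset.sum_le_sum fun i _ => Finset.sum_le_sum fun j _ =>
    hG.ite_le_pathMatrix i j).trans (sum_pathMatrix_le G)

lemma SimpleGraph.Connected.isTree_of_pathSpectralRadius_eq (hG : G.Connected)
    (h : pathSpectralRadius G = (n : ℝ) - 1) : G.IsTree := by
  refine ⟨hG, isAcyclic_of_maxDisjointPaths_le_one fun u v huv => ?_⟩
  have hle := sum_pathMatrix_le G
  rw [h, ← sum_ite_eq_zero_one] at hle
  have hrow (i : Fin n) := Finset.sum_le_sum fun j (_ : j ∈ Finset.univ) =>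
    hG.ite_le_pathMatrix i j
  have heq := le_antisymm (Finset.sum_le_sum fun i _ => hrow i) hle
  have hrow_eq := (Finset.sum_eq_sum_iff_of_le fun i _ => hrow i).1 heq u (Finset.mem_univ u)
  have huv_eq := (Finset.sum_eq_sum_iff_of_le fun j _ => hG.ite_le_pathMatrix u j).1 hrow_eq v
    (Finset.mem_univ v)
  rw [if_neg huv, pathMatrix_apply_of_ne huv] at huv_eq
  exact_mod_cast huv_eq.ge

lemma SimpleGraph.IsAcyclic.abs_pathMatrix_le_one (hG : G.IsAcyclic) (i j : Fin n) :
    |pathMatrix G i j| ≤ 1 := by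
  by_cases h : i = j
  · simp [h, pathMatrix_apply_self]
  · rw [pathMatrix_apply_of_ne h, Nat.abs_cast]
    exact_mod_cast hG.maxDisjointPaths_le_one i j

lemma SimpleGraph.IsTree.pathSpectralRadius_le (hG : G.IsTree) :
    pathSpectralRadius G ≤ (n : ℝ) - 1 := by
  have := hG.connected.nonempty
  have hn : 1 ≤ n := Fin.pos_iff_nonempty.2 this
  refine Real.sSup_le (fun x hx => ?_) (sub_nonneg.2 (by exact_mod_cast hn))
  obtain ⟨k, hk⟩ := Matrix.exists_le_sum_of_isRoot_charpoly hx
  rw [pathMatrix_apply_self, sub_zero] at hk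
  calc x ≤ |x| := le_abs_self x
    _ ≤ ∑ j ∈ Finset.univ.erase k, |pathMatrix G k j| := hk
    _ ≤ ∑ _j ∈ Finset.univ.erase k, (1 : ℝ) :=
      Finset.sum_le_sum fun j _ => hG.isAcyclic.abs_pathMatrix_le_one k j
    _ = (n : ℝ) - 1 := by
      simp [Finset.card_erase_of_mem, Nat.cast_sub hn]

end PathMatrix

/-- for a connected graph on n vertices, ρ(G) ≥ n − 1,
with equality iff G is a tree. -/
theorem path_spectral_radius_lower_bound {n : ℕ} (G : SimpleGraph (Fin n))
    (hG : G.Connected) :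
    (n : ℝ) - 1 ≤ pathSpectralRadius G ∧
      (pathSpectralRadius G = (n : ℝ) - 1 ↔ G.IsTree) :=
  ⟨hG.sub_one_le_pathSpectralRadius, hG.isTree_of_pathSpectralRadius_eq,
    fun h => le_antisymm h.pathSpectralRadius_le hG.sub_one_le_pathSpectralRadius⟩
end

section
/- Let G be a finite simple graph on n vertices with maximum vertex degree Δ. Then the trace of the path matrix P(G) is 0, and the trace of P(G)² (equivalently, the sum of the squares of the path eigenvalues of G) is at most n(n − 1)Δ². -/
open SimpleGraph Polynomial

/-- A path between distinct vertices whose second vertex is its endpoint is a single edge. -/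
theorem SimpleGraph.Walk.IsPath.eq_cons_nil_of_snd_eq {V : Type*} {G : SimpleGraph V} {u v : V}
    {p : G.Walk u v} (hp : p.IsPath) (huv : u ≠ v) (h : p.snd = v) :
    ∃ ha : G.Adj u v, p = .cons ha .nil := by
  cases p with
  | nil => exact absurd rfl huv
  | cons ha q =>
    rw [Walk.snd_cons] at h
    subst h
    obtain rfl := (Walk.isPath_iff_nil.mp hp.of_cons).eq_nil
    exact ⟨ha, rfl⟩

/-- There are at most `G.degree u` internally disjoint paths starting from `u`. -/
theorem maxDisjointPaths_le_degree {V : Type*} (G : SimpleGraph V) {u v : V}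
    [Fintype (G.neighborSet u)] (huv : u ≠ v) : maxDisjointPaths G u v ≤ G.degree u := by
  refine csSup_le' ?_
  rintro m ⟨f, hf, hd⟩
  have hadj (i : Fin m) : G.Adj u (f i).1.snd :=
    Walk.adj_snd (Walk.not_nil_of_ne huv)
  have hinj : Function.Injective fun i => (f i).1.snd := by
    intro i j hij
    by_contra hne
    have hij : (f i).1.snd = (f j).1.snd := hij
    have hi := (f i).1.getVert_mem_support 1
    have hj : (f i).1.snd ∈ (f j).1.support := hij ▸ (f j).1.getVert_mem_support 1
    rcases hd i j hne _ hi hj with h | h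
    · exact (hadj i).ne h.symm
    · obtain ⟨_, hpi⟩ := (f i).2.eq_cons_nil_of_snd_eq huv h
      obtain ⟨_, hpj⟩ := (f j).2.eq_cons_nil_of_snd_eq huv (hij ▸ h)
      exact hne (hf (Subtype.ext (hpi.trans hpj.symm)))
  rw [← card_neighborFinset_eq_degree]
  simpa using Finset.card_le_card_of_injOn (s := Finset.univ) (t := G.neighborFinset u)
    (fun i => (f i).1.snd) (fun i _ => by simpa using hadj i) hinj.injOn

/-- the trace of P(G) is 0 and the trace of P(G)² is at most n(n−1)Δ². -/
theorem pathMatrix_trace_and_trace_sq {n : ℕ} (G : SimpleGraph (Fin n))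
    [DecidableRel G.Adj] :
    (pathMatrix G).trace = 0 ∧
      (pathMatrix G * pathMatrix G).trace ≤
        (n : ℝ) * ((n : ℝ) - 1) * (G.maxDegree : ℝ) ^ 2 := by
  refine ⟨by simp [Matrix.trace, pathMatrix], ?_⟩
  have hle (i j : Fin n) : pathMatrix G i j * pathMatrix G j i ≤
      if i = j then 0 else (G.maxDegree : ℝ) ^ 2 := by
    by_cases h : i = j
    · simp [pathMatrix, h]
    · have hb {a b : Fin n} (hab : a ≠ b) : (maxDisjointPaths G a b : ℝ) ≤ G.maxDegree :=
        mod_cast (maxDisjointPaths_le_degree G hab).trans (G.degree_le_maxDegree a)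
      simp only [pathMatrix, Matrix.of_apply, if_neg h, if_neg (Ne.symm h), sq]
      exact mul_le_mul (hb h) (hb (Ne.symm h)) (by positivity) (by positivity)
  calc (pathMatrix G * pathMatrix G).trace
      = ∑ i, ∑ j, pathMatrix G i j * pathMatrix G j i := by
        simp [Matrix.trace, Matrix.mul_apply]
    _ ≤ ∑ i : Fin n, ∑ j : Fin n, if i = j then 0 else (G.maxDegree : ℝ) ^ 2 :=
        Finset.sum_le_sum fun i _ => Finset.sum_le_sum fun j _ => hle i j
    _ = (n : ℝ) * ((n : ℝ) - 1) * (G.maxDegree : ℝ) ^ 2 := by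
        have hsum (i : Fin n) : (∑ j : Fin n, if i = j then 0 else (G.maxDegree : ℝ) ^ 2) =
            ((n : ℝ) - 1) * (G.maxDegree : ℝ) ^ 2 := by
          have hsplit (j : Fin n) : (if i = j then 0 else (G.maxDegree : ℝ) ^ 2) =
              (G.maxDegree : ℝ) ^ 2 - if i = j then (G.maxDegree : ℝ) ^ 2 else 0 := by
            split_ifs <;> simp
          simp [hsplit, Finset.sum_sub_distrib, sub_mul]
        simp [hsum, mul_assoc]
end

section
/- Let C_n be the cycle graph on n ≥ 3 vertices. Then the path eigenvalues of C_n are −2 with multiplicity n − 1 and 2(n − 1) with multiplicity 1; consequently the path energy satisfies PE(C_n) = 4(n − 1). -/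
open SimpleGraph Polynomial

/-- A path from `u` to `v ≠ u` is determined by its second vertex when that vertex is `v`. -/
theorem SimpleGraph.Path.eq_of_snd_eq {V : Type*} {G : SimpleGraph V} {u v : V} (huv : u ≠ v)
    (p q : G.Path u v) (hp : p.1.snd = v) (hq : q.1.snd = v) : p = q := by
  obtain ⟨p, hp'⟩ := p
  obtain ⟨q, hq'⟩ := q
  cases p with
  | nil => exact absurd rfl huv
  | cons h p =>
    cases q with
    | nil => exact absurd rfl huv
    | cons h' q =>
      simp only [Walk.snd_cons] at hp hq
      subst hp
      subst hq
      obtain rfl := (Walk.isPath_iff_nil.1 hp'.of_cons).eq_nil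
      obtain rfl := (Walk.isPath_iff_nil.1 hq'.of_cons).eq_nil
      rfl

/-- A family of internally disjoint paths starting at `u` has at most `G.degree u` members. -/
theorem card_le_degree_of_internallyDisjoint {V : Type*} {G : SimpleGraph V} {u v : V}
    [Fintype (G.neighborSet u)] (huv : u ≠ v) {m : ℕ} (f : Fin m → G.Path u v)
    (hf : Function.Injective f)
    (hd : ∀ i j, i ≠ j → InternallyDisjoint (f i).1 (f j).1) : m ≤ G.degree u := by
  have hadj (i : Fin m) : G.Adj u (f i).1.snd := (f i).1.adj_snd (Walk.not_nil_of_ne huv)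
  have hmem (i : Fin m) : (f i).1.snd ∈ (f i).1.support := (f i).1.getVert_mem_support 1
  have hinj : Function.Injective fun i => (f i).1.snd := by
    intro i j hij
    by_contra hne
    have hij : (f i).1.snd = (f j).1.snd := hij
    rcases hd i j hne _ (hmem i) (hij ▸ hmem j) with h | h
    · exact (hadj i).ne h.symm
    · exact hne (hf (Path.eq_of_snd_eq huv _ _ h (hij ▸ h)))
  simpa using Finset.card_le_card_of_injOn (s := Finset.univ) (t := G.neighborFinset u)
    (fun i => (f i).1.snd) (fun i _ => by simpa using hadj i) hinj.injOn

open Fin.CommRing in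
/-- The walk of length `k` around the cycle in the positive direction. -/
theorem exists_cycleGraph_walk_add {n : ℕ} (k : ℕ) (u v : Fin (n + 2))
    (hv : u + (k : Fin (n + 2)) = v) :
    ∃ p : (cycleGraph (n + 2)).Walk u v,
      p.support = (List.range (k + 1)).map fun t : ℕ => u + (t : Fin (n + 2)) := by
  induction k generalizing u with
  | zero =>
    obtain rfl : u = v := by simpa using hv
    exact ⟨.nil, by simp⟩
  | succ k ih =>
    obtain ⟨p, hp⟩ := ih (u + 1) (by rw [← hv]; push_cast; ring)
    refine ⟨.cons (cycleGraph_adj.2 (.inr (by simp))) p, ?_⟩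
    rw [Walk.support_cons, hp, List.range_succ_eq_map (n := k + 1)]
    simp only [List.map_cons, List.map_map, Nat.cast_zero, add_zero, List.cons.injEq, true_and]
    refine List.map_congr_left fun t _ => ?_
    simp only [Function.comp_apply, Nat.succ_eq_add_one]
    push_cast
    ring

open Fin.CommRing in
/-- The path around the cycle from `u` to `v` in the positive direction. -/
theorem exists_cycleGraph_path {n : ℕ} (u v : Fin (n + 2)) :
    ∃ p : (cycleGraph (n + 2)).Path u v,
      ∀ w, w ∈ p.1.support ↔ (w - u).val ≤ (v - u).val := by
  obtain ⟨p, hp⟩ := exists_cycleGraph_walk_add (v - u).val u v (by simp)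
  refine ⟨⟨p, ?_⟩, fun w => ?_⟩
  · rw [Walk.isPath_def, hp]
    refine List.Nodup.map_on (fun s hs t ht hst => ?_) List.nodup_range
    have hlt := (v - u).isLt
    have hst := congrArg Fin.val (add_left_cancel hst)
    rw [List.mem_range] at hs ht
    rwa [Fin.val_natCast, Fin.val_natCast, Nat.mod_eq_of_lt (by omega),
      Nat.mod_eq_of_lt (by omega)] at hst
  · simp only [hp, List.mem_map, List.mem_range]
    constructor
    · rintro ⟨t, ht, rfl⟩
      rw [add_sub_cancel_left, Fin.val_natCast]
      exact (Nat.mod_le _ _).trans (by omega)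
    · intro h
      exact ⟨(w - u).val, by omega, by simp⟩

/-- Any two distinct vertices of a cycle are joined by exactly two internally disjoint paths. -/
theorem maxDisjointPaths_cycleGraph {n : ℕ} {u v : Fin (n + 3)} (huv : u ≠ v) :
    maxDisjointPaths (cycleGraph (n + 3)) u v = 2 := by
  refine IsGreatest.csSup_eq ⟨?_, ?_⟩
  · obtain ⟨p, hp⟩ := exists_cycleGraph_path u v
    obtain ⟨q, hq⟩ := exists_cycleGraph_path v u
    have hpq : InternallyDisjoint p.1 q.reverse.1 := by
      intro w hwp hwq
      rw [hp] at hwp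
      rw [Path.reverse_coe, Walk.support_reverse, List.mem_reverse, hq] at hwq
      have hval (a b : Fin (n + 3)) : b ≤ a ∧ (a - b).val = a.val - b.val ∨
          a < b ∧ (a - b).val = n + 3 + a.val - b.val :=
        (le_or_gt b a).imp (fun h => ⟨h, Fin.coe_sub_iff_le.2 h⟩)
          fun h => ⟨h, Fin.coe_sub_iff_lt.2 h⟩
      have h₁ := hval w u
      have h₂ := hval v u
      have h₃ := hval w v
      have h₄ := hval u v
      rw [Fin.le_def, Fin.lt_def] at h₁ h₂ h₃ h₄
      rw [Fin.ext_iff, Fin.ext_iff]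
      omega
    have hne : p ≠ q.reverse := by
      rintro h
      have hu : u + 1 ∈ p.1.support := by
        rw [hp, add_sub_cancel_left, Fin.val_one]
        exact Nat.one_le_iff_ne_zero.2 fun h => huv (sub_eq_zero.1 (Fin.ext h)).symm
      have hv : v + 1 ∈ q.reverse.1.support := by
        rw [Path.reverse_coe, Walk.support_reverse, List.mem_reverse, hq, add_sub_cancel_left,
          Fin.val_one]
        exact Nat.one_le_iff_ne_zero.2 fun h => huv (sub_eq_zero.1 (Fin.ext h))
      have h₁ : u + 1 = v := (hpq _ hu (h ▸ hu)).resolve_left (by simp)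
      have h₂ : v + 1 = u := (hpq _ (h ▸ hv) hv).resolve_right (by simp)
      rw [← h₁, add_assoc, add_eq_left] at h₂
      have := congrArg Fin.val h₂
      simp [Fin.val_add, Nat.mod_eq_of_lt] at this
    refine ⟨![p, q.reverse], ?_, ?_⟩
    · intro i j
      fin_cases i <;> fin_cases j <;> simp [hne, hne.symm]
    · intro i j
      fin_cases i <;> fin_cases j <;> simp only [ne_eq, not_true_eq_false, false_imp_iff]
      · exact fun _ => hpq
      · exact fun _ w h₁ h₂ => hpq w h₂ h₁
  · rintro m ⟨f, hf, hd⟩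
    exact (card_le_degree_of_internallyDisjoint huv f hf hd).trans cycleGraph_degree_three_le.le

theorem pathMatrix_cycleGraph (n : ℕ) :
    pathMatrix (cycleGraph (n + 3)) =
      Matrix.vecMulVec (fun _ => 2) (fun _ => 1) - Matrix.scalar (Fin (n + 3)) (2 : ℝ) := by
  ext i j
  by_cases h : i = j
  · subst h
    simp [pathMatrix, Matrix.vecMulVec_apply]
  · simp [pathMatrix, Matrix.vecMulVec_apply, h, maxDisjointPaths_cycleGraph h]

theorem charpoly_pathMatrix_cycleGraph (n : ℕ) :
    (pathMatrix (cycleGraph (n + 3))).charpoly =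
      (X - C (-2)) ^ (n + 2) * (X - C (2 * ((n : ℝ) + 2))) := by
  have hdot : (fun _ : Fin (n + 3) => (2 : ℝ)) ⬝ᵥ (fun _ => 1) = 2 * (n + 2) + 2 := by
    simp [dotProduct]
    ring
  rw [pathMatrix_cycleGraph, Matrix.charpoly_sub_scalar, Matrix.charpoly_vecMulVec, hdot,
    Fintype.card_fin, show n + 3 - 1 = n + 2 from rfl, smul_eq_C_mul, sub_comp, mul_comp,
    C_comp, X_pow_comp, X_pow_comp, C_add, C_neg]
  ring

/-- the path eigenvalues of C_n are −2 with multiplicity n − 1 and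
2(n − 1) with multiplicity 1, and PE(C_n) = 4(n − 1). -/
theorem path_spectrum_cycleGraph (n : ℕ) (hn : 3 ≤ n) :
    (pathMatrix (cycleGraph n)).charpoly.roots =
        Multiset.replicate (n - 1) (-2 : ℝ) + {2 * ((n : ℝ) - 1)} ∧
      pathEnergy (cycleGraph n) = 4 * ((n : ℝ) - 1) := by
  obtain ⟨n, rfl⟩ := Nat.exists_eq_add_of_le' hn
  have hroots : (pathMatrix (cycleGraph (n + 3))).charpoly.roots =
      Multiset.replicate (n + 3 - 1) (-2 : ℝ) + {2 * (((n + 3 : ℕ) : ℝ) - 1)} := by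
    rw [charpoly_pathMatrix_cycleGraph, roots_mul (mul_ne_zero
      (pow_ne_zero _ (X_sub_C_ne_zero _)) (X_sub_C_ne_zero _)), roots_pow, roots_X_sub_C,
      roots_X_sub_C, Multiset.nsmul_singleton]
    congr 2
    push_cast
    ring
  refine ⟨hroots, ?_⟩
  have hpos : (0 : ℝ) ≤ 2 * (((n + 3 : ℕ) : ℝ) - 1) := by
    push_cast
    linarith [n.cast_nonneg (α := ℝ)]
  rw [pathEnergy, hroots]
  simp only [Multiset.map_add, Multiset.map_replicate, Multiset.map_singleton, Multiset.sum_add,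
    Multiset.sum_replicate, Multiset.sum_singleton, abs_of_nonneg hpos, abs_neg, Nat.abs_ofNat,
    nsmul_eq_mul, show n + 3 - 1 = n + 2 from rfl]
  push_cast
  ring
end

section
/- Let G be a unicyclic simple graph on n vertices whose (unique) cycle C has length k, with 3 ≤ k ≤ n. Then for any two distinct vertices u, v of G, the entry p_{uv} of the path matrix equals 2 if both u and v lie on the cycle C, and equals 1 otherwise. -/
open SimpleGraph Polynomial

namespace SimpleGraph

variable {V : Type*} {G : SimpleGraph V} {u v x : V}

/-- Two distinct internally disjoint paths with the same endpoints form a cycle. -/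
lemma _root_.InternallyDisjoint.isCycle_append_reverse {p q : G.Walk u v}
    (h : InternallyDisjoint p q) (hp : p.IsPath) (hq : q.IsPath) (hne : p ≠ q) :
    (p.append q.reverse).IsCycle := by
  refine hp.isCycle_append hq.reverse (fun w hwp hwq => ?_) ?_
  · have hu : w ≠ u := by
      rintro rfl
      have := hp.support_nodup
      rw [← p.cons_tail_support] at this
      exact (List.nodup_cons.mp this).1 hwp
    have hv : w ≠ v := by
      rintro rfl
      have := hq.reverse.support_nodup
      rw [← q.reverse.cons_tail_support] at this
      exact (List.nodup_cons.mp this).1 hwq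
    have hwq' : w ∈ q.support := by simpa using List.mem_of_mem_tail hwq
    exact (h w (List.mem_of_mem_tail hwp) hwq').elim hu hv
  · by_contra! hle
    rw [Walk.length_reverse] at hle
    apply hne
    rcases p with _ | ⟨hadj, _ | _⟩ <;> rcases q with _ | ⟨hadj', _ | _⟩ <;> simp_all

/-- The two arcs of a cycle between two of its vertices are distinct internally disjoint paths. -/
lemma Walk.IsCycle.exists_internallyDisjoint {c : G.Walk x x} (hc : c.IsCycle)
    (hu : u ∈ c.support) (hv : v ∈ c.support) (huv : u ≠ v) :
    ∃ p q : G.Path u v, p ≠ q ∧ InternallyDisjoint p.1 q.1 := by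
  classical
  have hd := hc.rotate hu
  have hvd : v ∈ (c.rotate u hu).support := by simpa using hv
  generalize c.rotate u hu = d at hd hvd
  have happ : ((d.takeUntil v hvd).append (d.dropUntil v hvd)).IsCycle := by
    rwa [Walk.take_spec]
  generalize d.takeUntil v hvd = p at happ
  generalize d.dropUntil v hvd = q at happ
  have hp : p.IsPath := happ.isPath_of_append_left (Walk.not_nil_of_ne huv.symm)
  have hq : q.IsPath := happ.isPath_of_append_right (Walk.not_nil_of_ne huv)
  have htail := happ.support_nodup
  rw [Walk.tail_support_append, List.nodup_append'] at htail
  refine ⟨⟨p, hp⟩, ⟨q.reverse, hq.reverse⟩, fun h => ?_, fun w hwp hwq => ?_⟩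
  · have hpq : p = q.reverse := congrArg Subtype.val h
    have htrail := (Walk.isTrail_append _ _).mp happ.isTrail
    have hne : p.edges ≠ [] := fun h0 => Walk.not_nil_of_ne huv (Walk.edges_eq_nil.mp h0)
    obtain ⟨e, he⟩ := List.exists_mem_of_ne_nil _ hne
    exact htrail.2.2 he (by simpa [hpq] using he)
  · by_contra! hw
    have hwq' : w ∈ q.support := by simpa using hwq
    exact htail.2.2 ((p.mem_support_iff.mp hwp).resolve_left hw.1)
      ((q.mem_support_iff.mp hwq').resolve_left hw.2)

/-- In a connected graph with as many edges as vertices, all cycles have the same edges. -/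
lemma Connected.mem_edges_of_isCycle [Finite V] (hG : G.Connected)
    (hcard : Nat.card G.edgeSet = Nat.card V) {c : G.Walk x x} (hc : c.IsCycle)
    {d : G.Walk u u} (hd : d.IsCycle) {e : Sym2 V} (he : e ∈ c.edges) : e ∈ d.edges := by
  by_contra hed
  have heG := c.edges_subset_edgeSet he
  have htree : (G.deleteEdges {e}).IsTree := by
    rw [isTree_iff_connected_and_card]
    constructor
    · induction e with
      | h a b =>
        exact hG.connected_delete_edge_of_not_isBridge fun hb => hb.notMem_edges_of_isCycle hc he
    · rw [← hcard, edgeSet_deleteEdges, Nat.card_coe_set_eq, Nat.card_coe_set_eq]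
      exact Set.ncard_sdiff_singleton_add_one heG
  exact htree.isAcyclic _ (Walk.IsCycle.toDeleteEdges _ _ hd (by rintro _ h rfl; exact hed h))

lemma Connected.mem_support_of_isCycle [Finite V] (hG : G.Connected)
    (hcard : Nat.card G.edgeSet = Nat.card V) {c : G.Walk x x} (hc : c.IsCycle)
    {d : G.Walk u u} (hd : d.IsCycle) (hv : v ∈ c.support) : v ∈ d.support := by
  obtain ⟨e, he, hve⟩ := (Walk.mem_support_iff_exists_mem_edges_of_not_nil hc.not_nil).mp hv
  exact d.mem_support_of_mem_edges (hG.mem_edges_of_isCycle hcard hc hd he) hve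

lemma Connected.not_three_internallyDisjoint [Finite V] (hG : G.Connected)
    (hcard : Nat.card G.edgeSet = Nat.card V) {p q r : G.Walk u v}
    (hp : p.IsPath) (hq : q.IsPath) (hr : r.IsPath) (hpq : p ≠ q) (hpr : p ≠ r) (hqr : q ≠ r)
    (dpq : InternallyDisjoint p q) (dpr : InternallyDisjoint p r)
    (dqr : InternallyDisjoint q r) : False := by
  have cpq := dpq.isCycle_append_reverse hp hq hpq
  have cpr := dpr.isCycle_append_reverse hp hr hpr
  have cqr := dqr.isCycle_append_reverse hq hr hqr
  obtain ⟨e, he⟩ := List.exists_mem_of_ne_nil _ fun h0 => cpq.not_nil (Walk.edges_eq_nil.mp h0)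
  have h1 := hG.mem_edges_of_isCycle hcard cpq cpr he
  have h2 := hG.mem_edges_of_isCycle hcard cpq cqr he
  have t1 := ((Walk.isTrail_append _ _).mp cpq.isTrail).2.2
  have t2 := ((Walk.isTrail_append _ _).mp cpr.isTrail).2.2
  have t3 := ((Walk.isTrail_append _ _).mp cqr.isTrail).2.2
  simp only [Walk.edges_append, Walk.edges_reverse, List.mem_append, List.mem_reverse,
    List.disjoint_left] at *
  grind

end SimpleGraph

/-- in a unicyclic graph with cycle c of length k (3 ≤ k ≤ n),
p_{uv} = 2 if both u and v lie on the cycle, and p_{uv} = 1 otherwise. -/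
theorem pathMatrix_entries_unicyclic {n k : ℕ} (G : SimpleGraph (Fin n))
    (hG : G.Connected) (hedges : Nat.card G.edgeSet = n)
    (x : Fin n) (c : G.Walk x x) (hc : c.IsCycle) (hlen : c.length = k)
    (hk3 : 3 ≤ k) (hkn : k ≤ n) (u v : Fin n) (huv : u ≠ v) :
    maxDisjointPaths G u v =
      if u ∈ c.support ∧ v ∈ c.support then 2 else 1 := by
  have hcard : Nat.card G.edgeSet = Nat.card (Fin n) := by simpa using hedges
  refine IsGreatest.csSup_eq ?_
  split_ifs with h
  · refine ⟨?_, ?_⟩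
    · obtain ⟨p, q, hpq, hd⟩ := hc.exists_internallyDisjoint h.1 h.2 huv
      refine ⟨![p, q], ?_, ?_⟩
      · intro i j
        fin_cases i <;> fin_cases j <;> simp [hpq, hpq.symm]
      · intro i j
        fin_cases i <;> fin_cases j <;> simp [hd]
        exact fun w hq hp => hd w hp hq
    · rintro m ⟨f, hf, hd⟩
      by_contra! hm
      have hne : ∀ i j, i ≠ j → (f i).1 ≠ (f j).1 := fun i j hij he => hij (hf (Subtype.ext he))
      have h01 : (⟨0, by lia⟩ : Fin m) ≠ ⟨1, by lia⟩ := by simp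
      have h02 : (⟨0, by lia⟩ : Fin m) ≠ ⟨2, by lia⟩ := by simp
      have h12 : (⟨1, by lia⟩ : Fin m) ≠ ⟨2, by lia⟩ := by simp
      exact hG.not_three_internallyDisjoint hcard (f _).2 (f _).2 (f _).2 (hne _ _ h01)
        (hne _ _ h02) (hne _ _ h12) (hd _ _ h01) (hd _ _ h02) (hd _ _ h12)
  · refine ⟨?_, ?_⟩
    · obtain ⟨p, hp⟩ := hG.exists_isPath u v
      exact ⟨fun _ => ⟨p, hp⟩, Function.injective_of_subsingleton _,
        fun i j hij => (hij (Subsingleton.elim i j)).elim⟩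
    · rintro m ⟨f, hf, hd⟩
      by_contra! hm
      have h01 : (⟨0, by lia⟩ : Fin m) ≠ ⟨1, by lia⟩ := by simp
      have hcyc := (hd _ _ h01).isCycle_append_reverse (f _).2 (f _).2
        fun he => h01 (hf (Subtype.ext he))
      exact h ⟨hG.mem_support_of_isCycle hcard hcyc hc (by simp),
        hG.mem_support_of_isCycle hcard hcyc hc (by simp)⟩
end

section
/- Let n and k be integers with 3 ≤ k ≤ n − 1, and let M be the n×n real matrix with M_{ii} = 0 for all i, M_{ij} = 2 for i ≠ j with i, j ≤ k, and M_{ij} = 1 for all other i ≠ j. Then the characteristic polynomial of M factors as det(M − λI) = ±(λ + 2)^{k−1} (λ + 1)^{n−k−1} (λ² − (n + k − 3)λ − (k² − nk + 2n − 2)). -/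
open Polynomial

/-- The path matrix of a unicyclic graph on n vertices whose first k vertices
form the cycle: 0 on the diagonal, 2 between distinct cycle vertices, 1 otherwise. -/
def unicyclicPathMatrix (n k : ℕ) : Matrix (Fin n) (Fin n) ℝ :=
  Matrix.of fun i j =>
    if i = j then 0 else if i.val < k ∧ j.val < k then 2 else 1

/-- The left factor of the rank two part of `unicyclicPathMatrix n k`: its columns are the
all-ones vector and the indicator vector of the cycle. -/
def cycleIndicatorMatrix (n k : ℕ) : Matrix (Fin n) (Fin 2) ℝ :=
  Matrix.of fun i => ![1, if i.val < k then 1 else 0]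

theorem scalar_sub_unicyclicPathMatrix (n k : ℕ) (t : ℝ) :
    Matrix.scalar (Fin n) t - unicyclicPathMatrix n k =
      Matrix.diagonal (fun i : Fin n => if i.val < k then t + 2 else t + 1) +
        cycleIndicatorMatrix n k * -(cycleIndicatorMatrix n k).transpose := by
  ext i j
  by_cases hij : i = j
  · subst hij
    by_cases hi : i.val < k <;>
      simp [unicyclicPathMatrix, cycleIndicatorMatrix, Matrix.mul_apply, hi] <;>
      ring
  · by_cases hi : i.val < k <;> by_cases hj : j.val < k <;>
      simp [unicyclicPathMatrix, cycleIndicatorMatrix, Matrix.mul_apply, hij, hi, hj] <;>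
      norm_num

theorem prod_ite_val_lt (k m : ℕ) (a b : ℝ) :
    ∏ i : Fin (k + m), (if i.val < k then a else b) = a ^ k * b ^ m := by
  simp [Fin.prod_univ_add]

theorem one_sub_transpose_mul_cycleIndicatorMatrix (k m : ℕ) (a b : ℝ) :
    1 + -(cycleIndicatorMatrix (k + m) k).transpose *
        Matrix.diagonal (fun i : Fin (k + m) => if i.val < k then a else b) *
        cycleIndicatorMatrix (k + m) k =
      !![1 - (k * a + m * b), -(k * a); -(k * a), 1 - k * a] := by
  ext i j
  rw [Matrix.add_apply, Matrix.mul_apply]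
  simp only [Matrix.mul_diagonal]
  fin_cases i <;> fin_cases j <;> simp [cycleIndicatorMatrix, Fin.sum_univ_add] <;> ring

theorem det_scalar_sub_unicyclicPathMatrix (k m : ℕ) {t : ℝ} (ht : 0 < t) :
    (Matrix.scalar (Fin (k + m)) t - unicyclicPathMatrix (k + m) k).det =
      (t + 2) ^ k * (t + 1) ^ m *
        ((1 - (k * (t + 2)⁻¹ + m * (t + 1)⁻¹)) * (1 - k * (t + 2)⁻¹) - (k * (t + 2)⁻¹) ^ 2) := by
  have hdet : (Matrix.diagonal
      (fun i : Fin (k + m) => if i.val < k then t + 2 else t + 1)).det =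
        (t + 2) ^ k * (t + 1) ^ m := by
    rw [Matrix.det_diagonal, prod_ite_val_lt]
  have hinv : (Matrix.diagonal
      (fun i : Fin (k + m) => if i.val < k then t + 2 else t + 1))⁻¹ =
        Matrix.diagonal (fun i : Fin (k + m) => if i.val < k then (t + 2)⁻¹ else (t + 1)⁻¹) := by
    apply Matrix.inv_eq_right_inv
    rw [Matrix.diagonal_mul_diagonal, ← Matrix.diagonal_one]
    congr 1
    ext i
    split_ifs <;> exact mul_inv_cancel₀ (by positivity)
  rw [scalar_sub_unicyclicPathMatrix, Matrix.det_add_mul, hinv,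
    one_sub_transpose_mul_cycleIndicatorMatrix, hdet, Matrix.det_fin_two_of]
  · ring
  · rw [hdet, isUnit_iff_ne_zero]
    positivity

/-- the characteristic polynomial of M factors as
±(λ+2)^(k−1) (λ+1)^(n−k−1) (λ² − (n+k−3)λ − (k²−nk+2n−2)); since both
`M.charpoly = det (λI − M)` and the product below are monic of degree n,
this is exactly the claimed factorization. -/
theorem charpoly_unicyclicPathMatrix (n k : ℕ) (hk3 : 3 ≤ k) (hkn : k + 1 ≤ n) :
    (unicyclicPathMatrix n k).charpoly =
      (X + C 2) ^ (k - 1) * (X + C 1) ^ (n - k - 1) *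
        (X ^ 2 - C ((n : ℝ) + k - 3) * X
          - C ((k : ℝ) ^ 2 - n * k + 2 * n - 2)) := by
  obtain ⟨j, rfl⟩ : ∃ j, k = j + 1 := ⟨k - 1, by omega⟩
  obtain ⟨m, rfl⟩ : ∃ m, n = j + 1 + (m + 1) := ⟨n - (j + 1) - 1, by omega⟩
  refine eq_of_infinite_eval_eq _ _ ((Set.Ioi_infinite (0 : ℝ)).mono fun t ht => ?_)
  have ht : 0 < t := ht
  have hm : j + 1 + (m + 1) - (j + 1) - 1 = m := by omega
  rw [Set.mem_ofPred_eq, Matrix.eval_charpoly, det_scalar_sub_unicyclicPathMatrix _ _ ht, hm,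
    Nat.add_sub_cancel]
  simp only [eval_mul, eval_pow, eval_add, eval_sub, eval_X, eval_C]
  push_cast
  field_simp
  ring
end

section
/- Let n and k be integers with 3 ≤ k ≤ n − 1, and let M be the n×n real matrix with M_{ii} = 0 for all i, M_{ij} = 2 for i ≠ j with i, j ≤ k, and M_{ij} = 1 for all other i ≠ j. Then the eigenvalues of M are −2 with multiplicity k − 1, −1 with multiplicity n − k − 1, and the two numbers ρ_{1,2} = ( (n + k − 3) ± √((n + k − 3)² + 4(k² − nk + 2n − 2)) ) / 2, each with multiplicity 1. -/
open Polynomial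

/-- The determinant of a rank-two perturbation of an invertible diagonal matrix. -/
theorem det_diagonal_sub_one_add_mul {ι K : Type*} [Fintype ι] [DecidableEq ι] [Field K]
    (d u : ι → K) (hd : ∀ i, d i ≠ 0) :
    (Matrix.diagonal d - Matrix.of fun i j => 1 + u i * u j).det =
      (∏ i, d i) * ((1 - ∑ i, (d i)⁻¹) * (1 - ∑ i, u i ^ 2 * (d i)⁻¹) -
        (∑ i, u i * (d i)⁻¹) ^ 2) := by
  let U : Matrix ι (Fin 2) K := Matrix.of fun i => ![(d i)⁻¹, u i * (d i)⁻¹]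
  let V : Matrix (Fin 2) ι K := Matrix.of ![fun _ => 1, u]
  have factor : (Matrix.diagonal d - Matrix.of fun i j => 1 + u i * u j) =
      Matrix.diagonal d * (1 - U * V) := by
    ext i j
    have := hd i
    rw [mul_sub, mul_one, Matrix.sub_apply, Matrix.sub_apply, Matrix.diagonal_mul,
      Matrix.mul_apply, Fin.sum_univ_two]
    simp only [U, V, Matrix.of_apply, Matrix.cons_val_zero, Matrix.cons_val_one]
    field_simp
  rw [factor, Matrix.det_mul, Matrix.det_diagonal, Matrix.det_one_sub_mul_comm, Matrix.det_fin_two]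
  have hVU : V * U = !![∑ i, (d i)⁻¹, ∑ i, u i * (d i)⁻¹;
      ∑ i, u i * (d i)⁻¹, ∑ i, u i ^ 2 * (d i)⁻¹] := by
    ext a b
    rw [Matrix.mul_apply]
    fin_cases a <;> fin_cases b <;> simp [U, V, sq, mul_assoc]
  simp [hVU, sq]

theorem charpoly_unicyclicPathMatrix_add (k m : ℕ) (hk : 1 ≤ k) (hm : 1 ≤ m) :
    (unicyclicPathMatrix (k + m) k).charpoly =
      (X + C 2) ^ (k - 1) * (X + C 1) ^ (m - 1) *
        (X ^ 2 - C (2 * (k : ℝ) + m - 3) * X + C ((k : ℝ) * m - 2 * k - 2 * m + 2)) := by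
  refine Polynomial.eq_of_infinite_eval_eq _ _ ((Set.Ioi_infinite (0 : ℝ)).mono fun x hx => ?_)
  have hx : 0 < x := hx
  have h₁ : x + 1 ≠ 0 := by positivity
  have h₂ : x + 2 ≠ 0 := by positivity
  let d : Fin (k + m) → ℝ := fun i => if i.val < k then x + 2 else x + 1
  let u : Fin (k + m) → ℝ := fun i => if i.val < k then 1 else 0
  have hd : ∀ i, d i ≠ 0 := fun i => by dsimp only [d]; split_ifs <;> assumption
  have hM : Matrix.scalar (Fin (k + m)) x - unicyclicPathMatrix (k + m) k =
      Matrix.diagonal d - Matrix.of fun i j => 1 + u i * u j := by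
    ext i j
    by_cases hij : i = j
    · subst hij
      by_cases hi : i.val < k
      · simp [unicyclicPathMatrix, d, u, hi]
        ring
      · simp [unicyclicPathMatrix, d, u, hi]
    · by_cases hi : i.val < k <;> by_cases hj : j.val < k <;>
        norm_num [unicyclicPathMatrix, d, u, hi, hj, hij]
  rw [Set.mem_ofPred_eq, Matrix.eval_charpoly, hM, det_diagonal_sub_one_add_mul d u hd]
  obtain ⟨k, rfl⟩ := Nat.exists_eq_add_of_le' hk
  obtain ⟨m, rfl⟩ := Nat.exists_eq_add_of_le' hm
  simp only [Fin.prod_univ_add, Fin.sum_univ_add, d, u, Fin.val_castAdd, Fin.val_natAdd, Fin.is_lt,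
    if_true, not_lt.mpr (Nat.le_add_right _ _), if_false, Finset.prod_const, Finset.sum_const,
    Finset.card_univ, Fintype.card_fin, nsmul_eq_mul, Nat.add_sub_cancel, eval_mul, eval_pow,
    eval_add, eval_sub, eval_X, eval_C]
  push_cast
  field_simp
  ring

/-- the eigenvalues of M are −2 with multiplicity k − 1,
−1 with multiplicity n − k − 1, and ρ₁, ρ₂ each with multiplicity 1. -/
theorem eigenvalues_unicyclicPathMatrix (n k : ℕ) (hk3 : 3 ≤ k) (hkn : k + 1 ≤ n) :
    (unicyclicPathMatrix n k).charpoly.roots =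
      Multiset.replicate (k - 1) (-2 : ℝ) +
        Multiset.replicate (n - k - 1) (-1 : ℝ) +
        {(((n : ℝ) + k - 3) +
            Real.sqrt (((n : ℝ) + k - 3) ^ 2
              + 4 * ((k : ℝ) ^ 2 - n * k + 2 * n - 2))) / 2,
          (((n : ℝ) + k - 3) -
            Real.sqrt (((n : ℝ) + k - 3) ^ 2
              + 4 * ((k : ℝ) ^ 2 - n * k + 2 * n - 2))) / 2} := by
  obtain ⟨m, rfl⟩ := Nat.exists_eq_add_of_le (Nat.le_of_succ_le hkn)
  have hm : 1 ≤ m := by omega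
  rw [charpoly_unicyclicPathMatrix_add k m (by omega) hm, Nat.add_sub_cancel_left]
  push_cast
  set D : ℝ := ((k : ℝ) + m + k - 3) ^ 2
    + 4 * ((k : ℝ) ^ 2 - (k + m) * k + 2 * (k + m) - 2) with hD
  have hD_nonneg : 0 ≤ D := by
    have : D = (k - 1 + (k - m : ℝ)) ^ 2 + 4 * (k * m : ℝ) := by rw [hD]; ring
    rw [this]; positivity
  have hs := Real.sq_sqrt hD_nonneg
  set s := Real.sqrt D
  set r₁ : ℝ := ((k : ℝ) + m + k - 3 + s) / 2 with hr₁
  set r₂ : ℝ := ((k : ℝ) + m + k - 3 - s) / 2 with hr₂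
  have hsum : 2 * (k : ℝ) + m - 3 = r₁ + r₂ := by rw [hr₁, hr₂]; ring
  have hprod : (k : ℝ) * m - 2 * k - 2 * m + 2 = r₁ * r₂ := by
    rw [hr₁, hr₂]; linear_combination (1 / 4) * hs + (1 / 4) * hD
  have hfac : ((X + C 2) ^ (k - 1) * (X + C 1) ^ (m - 1) *
        (X ^ 2 - C (2 * (k : ℝ) + m - 3) * X + C ((k : ℝ) * m - 2 * k - 2 * m + 2)) : ℝ[X]) =
      ((Multiset.replicate (k - 1) (-2 : ℝ) + Multiset.replicate (m - 1) (-1 : ℝ) +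
        {r₁, r₂}).map fun a => X - C a).prod := by
    rw [hsum, hprod]
    simp only [Multiset.map_add, Multiset.prod_add, Multiset.map_replicate,
      Multiset.prod_replicate, Multiset.insert_eq_cons, Multiset.map_cons, Multiset.map_singleton,
      Multiset.prod_cons, Multiset.prod_singleton, C_neg, sub_neg_eq_add, C_add, C_mul]
    ring
  rw [hfac, roots_multiset_prod_X_sub_C]
end

section
/- Let G be a unicyclic simple graph on n vertices with cycle length k, where 3 ≤ k ≤ n − 1. If n ≥ 7 and 3 ≤ k ≤ n − 3, then the path energy satisfies PE(G) = 2(n + k − 3); otherwise (n < 7, or k ∈ {n − 2, n − 1}), PE(G) = n + k − 3 + √((n + k − 3)² + 4(k² − nk + 2n − 2)). -/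
open SimpleGraph Polynomial

/-- Two distinct internally disjoint paths with common endpoints form a cycle. -/
lemma InternallyDisjoint.isCycle_append_reverse_s12 {V : Type*} {G : SimpleGraph V} {u v : V}
    {p q : G.Walk u v} (h : InternallyDisjoint p q) (hp : p.IsPath) (hq : q.IsPath)
    (hne : p ≠ q) : (p.append q.reverse).IsCycle := by
  refine hp.isCycle_append (Walk.isPath_reverse_iff q |>.mpr hq) (fun w hw hw' ↦ ?_) ?_
  · have hu : u ∉ p.support.tail := by
      have := hp.support_nodup
      rw [← Walk.cons_tail_support] at this
      exact (List.nodup_cons.mp this).1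
    have hv : v ∉ q.reverse.support.tail := by
      have := ((Walk.isPath_reverse_iff q).mpr hq).support_nodup
      rw [← Walk.cons_tail_support] at this
      exact (List.nodup_cons.mp this).1
    rcases h w (List.mem_of_mem_tail hw) (by simpa using List.mem_of_mem_tail hw') with rfl | rfl
    · exact hu hw
    · exact hv hw'
  · by_contra! hl
    rw [Walk.length_reverse] at hl
    exact hne (Walk.eq_of_length_le_one hl.1 hl.2)

/-- In a connected graph with as many edges as vertices, every edge of a cycle lies on
every cycle. -/
lemma SimpleGraph.Walk.IsCycle.edges_subset_of_card_edgeSet {V : Type*} [Finite V]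
    {G : SimpleGraph V} (hG : G.Connected) (hcard : Nat.card G.edgeSet = Nat.card V)
    {x y : V} {c : G.Walk x x} {d : G.Walk y y} (hc : c.IsCycle) (hd : d.IsCycle) :
    c.edges ⊆ d.edges := by
  intro e he
  by_contra hed
  have heG := c.edges_subset_edgeSet he
  have hconn : (G.deleteEdges {e}).Connected := by
    induction e with
    | h a b =>
      exact hG.connected_delete_edge_of_not_isBridge fun hb ↦ hb.notMem_edges_of_isCycle hc he
  have htree : (G.deleteEdges {e}).IsTree := by
    rw [isTree_iff_connected_and_card]
    refine ⟨hconn, ?_⟩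
    rw [edgeSet_deleteEdges, Nat.card_coe_set_eq, Set.ncard_sdiff_singleton_add_one heG
      (Set.toFinite _), ← Nat.card_coe_set_eq, hcard]
  refine htree.isAcyclic _ (hd.toDeleteEdges G {e} fun e' he' h ↦ hed ?_)
  rw [Set.mem_singleton_iff] at h
  exact h ▸ he'

/-- Two vertices of a cycle are joined by two internally disjoint paths. -/
lemma SimpleGraph.Walk.IsCycle.exists_internallyDisjoint_s12 {V : Type*} {G : SimpleGraph V}
    {x u v : V} {c : G.Walk x x} (hc : c.IsCycle) (hu : u ∈ c.support) (hv : v ∈ c.support)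
    (huv : u ≠ v) : ∃ p q : G.Path u v, p ≠ q ∧ InternallyDisjoint p.1 q.1 := by
  classical
  obtain ⟨d, hd, hvd⟩ : ∃ d : G.Walk u u, d.IsCycle ∧ v ∈ d.support :=
    ⟨c.rotate u hu, hc.rotate hu, by rwa [Walk.mem_support_rotate_iff]⟩
  have hspec := d.take_spec hvd
  set p := d.takeUntil v hvd
  set q := d.dropUntil v hvd
  rw [← hspec] at hd
  have hp : p.IsPath := hd.isPath_of_append_left (Walk.not_nil_of_ne huv.symm)
  have hq : q.IsPath := hd.isPath_of_append_right (Walk.not_nil_of_ne huv)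
  have hdisj : InternallyDisjoint p q.reverse := by
    intro w hwp hwq
    rw [Walk.support_reverse, List.mem_reverse] at hwq
    have hnd := hd.support_nodup
    rw [Walk.tail_support_append, List.nodup_append'] at hnd
    rw [Walk.mem_support_iff] at hwp hwq
    rcases hwp with h | hwp
    · exact Or.inl h
    rcases hwq with h | hwq
    · exact Or.inr h
    exact (hnd.2.2 hwp hwq).elim
  refine ⟨⟨p, hp⟩, ⟨q.reverse, (Walk.isPath_reverse_iff q).mpr hq⟩, fun h ↦ ?_, hdisj⟩
  have hpq : p = q.reverse := congrArg Subtype.val h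
  have htrail := hd.isTrail.edges_nodup
  rw [Walk.edges_append, List.nodup_append'] at htrail
  have hne : p.edges ≠ [] := by
    intro h
    rw [Walk.edges_eq_nil] at h
    exact Walk.not_nil_of_ne huv h
  obtain ⟨e, he⟩ := List.exists_mem_of_ne_nil _ hne
  refine htrail.2.2 he ?_
  rw [hpq, Walk.edges_reverse, List.mem_reverse] at he
  exact he

/-- In a connected graph with as many edges as vertices and with cycle `c`, the maximum number of
internally disjoint paths between distinct vertices is `2` if both lie on `c` and `1` otherwise. -/
lemma maxDisjointPaths_eq_ite {V : Type*} [Finite V]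
    {G : SimpleGraph V} (hG : G.Connected) (hcard : Nat.card G.edgeSet = Nat.card V)
    {x : V} {c : G.Walk x x} (hc : c.IsCycle) {u v : V} (huv : u ≠ v)
    [Decidable (u ∈ c.support ∧ v ∈ c.support)] :
    maxDisjointPaths G u v = if u ∈ c.support ∧ v ∈ c.support then 2 else 1 := by
  have htwo {p q : G.Path u v} (hne : p ≠ q) (h : InternallyDisjoint p.1 q.1) :
      (p.1.append q.1.reverse).IsCycle :=
    h.isCycle_append_reverse_s12 p.2 q.2 fun h ↦ hne (Subtype.ext h)
  have hmem {p q : G.Path u v} (hne : p ≠ q) (h : InternallyDisjoint p.1 q.1) {w : V}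
      (hw : w = u ∨ w = v) : w ∈ c.support := by
    have hd := htwo hne h
    have hwd : w ∈ (p.1.append q.1.reverse).support := by
      rcases hw with rfl | rfl <;> simp [Walk.mem_support_append_iff]
    obtain ⟨e, he, hwe⟩ := (Walk.mem_support_iff_exists_mem_edges_of_not_nil hd.not_nil).mp hwd
    exact Walk.mem_support_of_mem_edges (hd.edges_subset_of_card_edgeSet hG hcard hc he) hwe
  have hle {m : ℕ} (f : Fin m → G.Path u v) (hf : Function.Injective f)
      (hd : ∀ i j, i ≠ j → InternallyDisjoint (f i).1 (f j).1) : m ≤ 2 := by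
    by_contra! hm
    have hij {a b : ℕ} (ha : a < m) (hb : b < m) (hab : a ≠ b) :
        ((f ⟨a, ha⟩).1.append (f ⟨b, hb⟩).1.reverse).IsCycle :=
      htwo (hf.ne (by simpa using hab)) (hd _ _ (by simpa using hab))
    have h01 := hij (a := 0) (b := 1) (by omega) (by omega) (by omega)
    have h02 := hij (a := 0) (b := 2) (by omega) (by omega) (by omega)
    have h12 := hij (a := 1) (b := 2) (by omega) (by omega) (by omega)
    have hne : (f ⟨1, by omega⟩).1.edges ≠ [] := by
      intro h
      rw [Walk.edges_eq_nil] at h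
      exact Walk.not_nil_of_ne huv h
    obtain ⟨e, he⟩ := List.exists_mem_of_ne_nil _ hne
    have he' := h01.edges_subset_of_card_edgeSet hG hcard h02 (a := e) (by simp [he])
    have n01 := h01.isTrail.edges_nodup
    have n12 := h12.isTrail.edges_nodup
    simp only [Walk.edges_append, Walk.edges_reverse, List.mem_append, List.mem_reverse,
      List.nodup_append'] at he' n01 n12
    rcases he' with h | h
    · exact n01.2.2 h (by simpa using he)
    · exact n12.2.2 he (by simpa using h)
  have hbdd : BddAbove {m : ℕ | ∃ f : Fin m → G.Path u v, Function.Injective f ∧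
      ∀ i j, i ≠ j → InternallyDisjoint (f i).1 (f j).1} :=
    ⟨2, fun m ⟨f, hf, hd⟩ ↦ hle f hf hd⟩
  obtain ⟨r, hr⟩ := hG.exists_isPath u v
  have hone : 1 ∈ {m : ℕ | ∃ f : Fin m → G.Path u v, Function.Injective f ∧
      ∀ i j, i ≠ j → InternallyDisjoint (f i).1 (f j).1} :=
    ⟨fun _ ↦ ⟨r, hr⟩, Function.injective_of_subsingleton _,
      fun i j h ↦ (h (Subsingleton.elim i j)).elim⟩
  unfold maxDisjointPaths
  split_ifs with h
  · refine le_antisymm (csSup_le ⟨1, hone⟩ fun m ⟨f, hf, hd⟩ ↦ hle f hf hd) (le_csSup hbdd ?_)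
    obtain ⟨p, q, hne, hpq⟩ := hc.exists_internallyDisjoint_s12 h.1 h.2 huv
    have hqp : InternallyDisjoint q.1 p.1 := fun w h₁ h₂ ↦ hpq w h₂ h₁
    refine ⟨![p, q], ?_, ?_⟩
    · intro i j
      fin_cases i <;> fin_cases j <;> simp [hne, hne.symm]
    · intro i j hij
      fin_cases i <;> fin_cases j <;> simp_all
  · refine le_antisymm (csSup_le ⟨1, hone⟩ fun m ⟨f, hf, hd⟩ ↦ ?_) (le_csSup hbdd hone)
    by_contra! hm
    have h01 : (⟨0, by omega⟩ : Fin m) ≠ ⟨1, by omega⟩ := by simp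
    exact h ⟨hmem (hf.ne h01) (hd _ _ h01) (Or.inl rfl), hmem (hf.ne h01) (hd _ _ h01) (Or.inr rfl)⟩

open Matrix in
/-- Determinant of `t - M` where `M` has zero diagonal, entries `2` inside `S` and `1` elsewhere. -/
lemma det_scalar_sub_of_ite {ι : Type*} [Fintype ι] [DecidableEq ι] (S : Finset ι) {a b : ℕ}
    (hS : S.card = a + 1) (hSc : Sᶜ.card = b + 1) {t : ℝ} (h1 : t + 1 ≠ 0) (h2 : t + 2 ≠ 0) :
    (scalar ι t - of fun i j ↦ if i = j then (0 : ℝ) else if i ∈ S ∧ j ∈ S then 2 else 1).det =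
      (t + 2) ^ a * (t + 1) ^ b *
        ((t + 2 - 2 * (a + 1)) * (t + 1 - (b + 1)) - (a + 1) * (b + 1)) := by
  set d : ι → ℝ := fun i ↦ if i ∈ S then t + 2 else t + 1 with hd
  have hd0 (i : ι) : d i ≠ 0 := by
    rw [hd]
    dsimp only
    split_ifs <;> assumption
  let U : Matrix ι (Fin 2) ℝ := of fun i ↦ ![if i ∈ S then 1 else 0, if i ∈ S then 0 else 1]
  let W : Matrix (Fin 2) ι ℝ := of ![fun j ↦ if j ∈ S then 2 else 1, fun _ ↦ 1]
  have hfac : (scalar ι t - of fun i j ↦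
      if i = j then (0 : ℝ) else if i ∈ S ∧ j ∈ S then 2 else 1) =
      diagonal d * (1 - diagonal (fun i ↦ (d i)⁻¹) * U * W) := by
    ext i j
    rw [Matrix.mul_assoc, Matrix.mul_sub, Matrix.mul_one, ← Matrix.mul_assoc, diagonal_mul_diagonal]
    have : (fun i ↦ d i * (d i)⁻¹) = fun _ ↦ (1 : ℝ) := funext fun i ↦ mul_inv_cancel₀ (hd0 i)
    rw [this, diagonal_one, Matrix.one_mul]
    simp only [Matrix.sub_apply, scalar_apply, of_apply, diagonal_apply, Matrix.mul_apply, Fin.sum_univ_two, U, W,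
      hd]
    by_cases hij : i = j
    · subst hij
      by_cases hi : i ∈ S <;> simp [hi]
    · by_cases hi : i ∈ S <;> by_cases hj : j ∈ S <;> simp [hi, hj, hij]
  have hsum (f g : ℝ) : ∑ i, (if i ∈ S then f else g) = (a + 1) * f + (b + 1) * g := by
    rw [Finset.sum_ite, Finset.sum_const, Finset.sum_const, Finset.filter_mem_eq_inter,
      Finset.univ_inter, Finset.filter_notMem_eq_sdiff, ← Finset.compl_eq_univ_sdiff, hS, hSc]
    simp
  have hprod : ∏ i, d i = (t + 2) ^ (a + 1) * (t + 1) ^ (b + 1) := by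
    rw [hd, Finset.prod_ite, Finset.prod_const, Finset.prod_const, Finset.filter_mem_eq_inter,
      Finset.univ_inter, Finset.filter_notMem_eq_sdiff, ← Finset.compl_eq_univ_sdiff, hS, hSc]
  have hent : W * (diagonal (fun i ↦ (d i)⁻¹) * U) =
      !![(a + 1) * (2 * (t + 2)⁻¹), (b + 1) * (t + 1)⁻¹;
        (a + 1) * (t + 2)⁻¹, (b + 1) * (t + 1)⁻¹] := by
    have hrw (i j) : (W * (diagonal (fun i ↦ (d i)⁻¹) * U)) i j =
        ∑ x, (if x ∈ S then W i x * ((t + 2)⁻¹ * U x j) else W i x * ((t + 1)⁻¹ * U x j)) := by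
      rw [Matrix.mul_apply]
      refine Finset.sum_congr rfl fun x _ ↦ ?_
      rw [diagonal_mul]
      by_cases hx : x ∈ S <;> simp [hd, hx]
    ext i j
    rw [hrw]
    fin_cases i <;> fin_cases j
    · refine (Finset.sum_congr rfl fun x _ ↦ ?_).trans ((hsum (2 * (t + 2)⁻¹) 0).trans (by simp))
      by_cases hx : x ∈ S <;> simp [U, W, hx]
    · refine (Finset.sum_congr rfl fun x _ ↦ ?_).trans ((hsum 0 (t + 1)⁻¹).trans (by simp))
      by_cases hx : x ∈ S <;> simp [U, W, hx]
    · refine (Finset.sum_congr rfl fun x _ ↦ ?_).trans ((hsum (t + 2)⁻¹ 0).trans (by simp))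
      by_cases hx : x ∈ S <;> simp [U, W, hx]
    · refine (Finset.sum_congr rfl fun x _ ↦ ?_).trans ((hsum 0 (t + 1)⁻¹).trans (by simp))
      by_cases hx : x ∈ S <;> simp [U, W, hx]
  rw [hfac, det_mul, det_diagonal, det_one_sub_mul_comm, hprod, hent, det_fin_two]
  simp only [Matrix.sub_apply, one_apply_eq, of_apply, cons_val', cons_val_zero, cons_val_one,
    cons_val_fin_one, Ne, zero_ne_one, one_ne_zero, not_false_eq_true, one_apply_ne]
  field_simp
  ring

/-- The sum of absolute values of the eigenvalues of the real matrix with zero diagonal, entries `2`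
inside `S` and `1` elsewhere. -/
lemma sum_abs_roots_charpoly_of_ite {ι : Type*} [Fintype ι] [DecidableEq ι] (S : Finset ι)
    {a b : ℕ} (hS : S.card = a + 1) (hSc : Sᶜ.card = b + 1) {r₁ r₂ : ℝ}
    (hadd : r₁ + r₂ = 2 * a + b) (hmul : r₁ * r₂ = 2 * a * b - (a + 1) * (b + 1)) :
    ((Matrix.charpoly (Matrix.of fun i j : ι ↦
      if i = j then (0 : ℝ) else if i ∈ S ∧ j ∈ S then 2 else 1)).roots.map (|·|)).sum =
      2 * a + b + |r₁| + |r₂| := by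
  have hchar : Matrix.charpoly (Matrix.of fun i j : ι ↦
      if i = j then (0 : ℝ) else if i ∈ S ∧ j ∈ S then 2 else 1) =
      (X - C (-2)) ^ a * (X - C (-1)) ^ b * ((X - C r₁) * (X - C r₂)) := by
    refine Polynomial.eq_of_infinite_eval_eq _ _ ?_
    refine Set.Infinite.mono (s := Set.Ioi 0) (fun t ht ↦ ?_) (Set.Ioi_infinite 0)
    have ht : 0 < t := ht
    rw [Set.mem_ofPred_eq, Matrix.eval_charpoly,
      det_scalar_sub_of_ite S hS hSc (by positivity) (by positivity)]
    simp only [eval_mul, eval_pow, eval_sub, eval_X, eval_C, sub_neg_eq_add]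
    congr 1
    linear_combination t * hadd - hmul
  have h0 : ∀ r : ℝ, (X - C r : ℝ[X]) ≠ 0 := X_sub_C_ne_zero
  have hpow : ((X - C (-2)) ^ a * (X - C (-1)) ^ b : ℝ[X]) ≠ 0 :=
    mul_ne_zero (pow_ne_zero _ (h0 _)) (pow_ne_zero _ (h0 _))
  rw [hchar, roots_mul (mul_ne_zero hpow (mul_ne_zero (h0 _) (h0 _))), roots_mul hpow,
    roots_mul (mul_ne_zero (h0 _) (h0 _)), roots_pow, roots_pow]
  simp only [roots_X_sub_C, Multiset.map_add, Multiset.sum_add, Multiset.map_nsmul,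
    Multiset.sum_nsmul, Multiset.map_singleton, Multiset.sum_singleton, abs_neg, nsmul_eq_mul]
  norm_num
  ring

/-- path energy of a unicyclic graph on n vertices with cycle
length k, 3 ≤ k ≤ n − 1. -/
theorem pathEnergy_unicyclic {n k : ℕ} (G : SimpleGraph (Fin n))
    (hG : G.Connected) (hedges : Nat.card G.edgeSet = n)
    (x : Fin n) (c : G.Walk x x) (hc : c.IsCycle) (hlen : c.length = k)
    (hk3 : 3 ≤ k) (hkn : k + 1 ≤ n) :
    (7 ≤ n ∧ k + 3 ≤ n → pathEnergy G = 2 * ((n : ℝ) + k - 3)) ∧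
    (n < 7 ∨ n ≤ k + 2 →
      pathEnergy G = (n : ℝ) + k - 3 +
        Real.sqrt (((n : ℝ) + k - 3) ^ 2
          + 4 * ((k : ℝ) ^ 2 - n * k + 2 * n - 2))) := by
  have hcard : Nat.card G.edgeSet = Nat.card (Fin n) := by rw [hedges, Nat.card_fin]
  set S : Finset (Fin n) := c.support.toFinset with hSdef
  have hScard : S.card = k := by
    have hS : S = c.support.tail.toFinset := by
      rw [hSdef, ← c.cons_tail_support, List.toFinset_cons,
        Finset.insert_eq_of_mem (by simpa using c.end_mem_tail_support hc.not_nil)]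
      rfl
    rw [hS, List.toFinset_card_of_nodup hc.support_nodup, List.length_tail, Walk.length_support,
      hlen, Nat.add_sub_cancel]
  obtain ⟨a, rfl⟩ : ∃ a, k = a + 1 := ⟨k - 1, by omega⟩
  obtain ⟨b, hb⟩ : ∃ b, n = a + 1 + (b + 1) := ⟨n - (a + 1) - 1, by omega⟩
  have hSc : Sᶜ.card = b + 1 := by
    rw [Finset.card_compl, hScard, Fintype.card_fin]
    omega
  have hP : pathMatrix G =
      Matrix.of fun i j ↦ if i = j then (0 : ℝ) else if i ∈ S ∧ j ∈ S then 2 else 1 := by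
    ext i j
    simp only [pathMatrix, Matrix.of_apply]
    split_ifs with hij hS
    · rfl
    · rw [maxDisjointPaths_eq_ite hG hcard hc hij, if_pos (by simpa [hSdef] using hS)]
      norm_num
    · rw [maxDisjointPaths_eq_ite hG hcard hc hij, if_neg (by simpa [hSdef] using hS)]
      norm_num
  have hn : (n : ℝ) = a + b + 2 := by
    rw [hb]
    push_cast
    ring
  set T : ℝ := (n : ℝ) + ((a + 1 : ℕ) : ℝ) - 3 with hT
  set D : ℝ := ((a + 1 : ℕ) : ℝ) ^ 2 - n * ((a + 1 : ℕ) : ℝ) + 2 * n - 2 with hD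
  have hT' : T = 2 * a + b := by
    rw [hT, hn]
    push_cast
    ring
  have hD' : D = (a + 1) * (b + 1) - 2 * a * b := by
    rw [hD, hn]
    push_cast
    ring
  have hT0 : 0 ≤ T := by
    rw [hT']
    positivity
  have hdisc : 0 ≤ T ^ 2 + 4 * D := by
    have : T ^ 2 + 4 * D = (2 * a - b) ^ 2 + 4 * ((a + 1) * (b + 1)) := by
      rw [hT', hD']
      ring
    rw [this]
    positivity
  have hsq := Real.sq_sqrt hdisc
  have hs0 := Real.sqrt_nonneg (T ^ 2 + 4 * D)
  have henergy : pathEnergy G = T + |(T + √(T ^ 2 + 4 * D)) / 2| +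
      |(T - √(T ^ 2 + 4 * D)) / 2| := by
    rw [pathEnergy, hP, sum_abs_roots_charpoly_of_ite S hScard hSc
      (r₁ := (T + √(T ^ 2 + 4 * D)) / 2) (r₂ := (T - √(T ^ 2 + 4 * D)) / 2), hT']
    · rw [← hT']
      ring
    · linear_combination -hsq / 4 - hD'
  rw [abs_of_nonneg (a := (T + √(T ^ 2 + 4 * D)) / 2) (by positivity)] at henergy
  constructor
  · rintro ⟨h7, hk⟩
    have hD0 : D ≤ 0 := by
      have : (a + 1) * (b + 1) ≤ 2 * a * b := by
        rcases (show a = 2 ∧ 3 ≤ b ∨ 3 ≤ a ∧ 2 ≤ b by omega) with ⟨rfl, h⟩ | ⟨h₁, h₂⟩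
        · omega
        · nlinarith
      rw [hD', sub_nonpos]
      exact_mod_cast this
    have hle : √(T ^ 2 + 4 * D) ≤ T := Real.sqrt_le_iff.mpr ⟨hT0, by linarith⟩
    rw [henergy, abs_of_nonneg (by linarith)]
    ring
  · intro h
    have hD0 : 0 ≤ D := by
      have : 2 * a * b ≤ (a + 1) * (b + 1) := by
        rcases (show b = 0 ∨ b = 1 ∨ a = 2 ∧ b = 2 by omega) with rfl | rfl | ⟨rfl, rfl⟩ <;> omega
      rw [hD', sub_nonneg]
      exact_mod_cast this
    have hle : T ≤ √(T ^ 2 + 4 * D) := Real.le_sqrt_of_sq_le (by linarith)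
    rw [henergy, abs_of_nonpos (by linarith)]
    ring
end

section
/- Let n ≥ 4 and let G be a unicyclic simple graph on n vertices. Then the path spectral radius satisfies ρ(G) ≤ 2(n − 1) < (n − 1)², and the maximum value 2(n − 1) is attained exactly when G is the cycle C_n. -/
open SimpleGraph Polynomial

namespace SimpleGraph

variable {V : Type*} {G : SimpleGraph V} {u v : V}

lemma Walk.IsPath.length_eq_one_of_snd_eq {p : G.Walk u v} (hp : p.IsPath) (huv : u ≠ v)
    (h : p.snd = v) : p.length = 1 := by
  have hpos : 1 ≤ p.length := by
    rw [Nat.one_le_iff_ne_zero]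
    exact fun h0 => huv (Walk.eq_of_length_eq_zero h0)
  exact ((hp.getVert_eq_end_iff hpos).mp h).symm

lemma Walk.eq_of_length_eq_one {p q : G.Walk u v} (hp : p.length = 1) (hq : q.length = 1) :
    p = q := by
  refine Walk.ext_getVert_le_length (hp.trans hq.symm) fun k hk => ?_
  obtain rfl | rfl : k = 0 ∨ k = 1 := by omega
  · simp
  · rw [← hp, Walk.getVert_length, hp, ← hq, Walk.getVert_length]

/-- Among injectively listed internally disjoint paths, the second vertices are distinct. -/
lemma snd_injective_of_internallyDisjoint (huv : u ≠ v) {m : ℕ} {f : Fin m → G.Path u v}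
    (hf : Function.Injective f)
    (hd : ∀ i j, i ≠ j → InternallyDisjoint (f i).1 (f j).1) :
    Function.Injective fun i => (f i).1.snd := by
  intro i j hij
  by_contra hne
  replace hij : (f i).1.snd = (f j).1.snd := hij
  have hnil (k) : ¬ (f k).1.Nil := Walk.not_nil_of_ne huv
  have hend : (f i).1.snd = v := by
    refine (hd i j hne _ (Walk.getVert_mem_support _ _) ?_).resolve_left ?_
    · change (f i).1.snd ∈ _
      rw [hij]
      exact Walk.getVert_mem_support _ _
    · exact (Walk.adj_snd (hnil i)).ne'
  exact hne <| hf <| Subtype.ext <| Walk.eq_of_length_eq_one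
    ((f i).2.length_eq_one_of_snd_eq huv hend)
    ((f j).2.length_eq_one_of_snd_eq huv (hij ▸ hend))

lemma card_le_degree_of_internallyDisjoint [Fintype (G.neighborSet u)] (huv : u ≠ v) {m : ℕ}
    {f : Fin m → G.Path u v} (hf : Function.Injective f)
    (hd : ∀ i j, i ≠ j → InternallyDisjoint (f i).1 (f j).1) : m ≤ G.degree u := by
  have hcard := Finset.card_le_card_of_injOn (s := Finset.univ) (t := G.neighborFinset u)
    (fun i => (f i).1.snd)
    (fun i _ => by simpa using Walk.adj_snd (Walk.not_nil_of_ne huv))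
    (snd_injective_of_internallyDisjoint huv hf hd).injOn
  simpa using hcard

lemma maxDisjointPaths_le_degree_left [Fintype (G.neighborSet u)] (huv : u ≠ v) :
    maxDisjointPaths G u v ≤ G.degree u :=
  csSup_le' fun _ ⟨_, hf, hd⟩ => card_le_degree_of_internallyDisjoint huv hf hd

lemma maxDisjointPaths_le_degree_right [Fintype (G.neighborSet v)] (huv : u ≠ v) :
    maxDisjointPaths G u v ≤ G.degree v := by
  refine csSup_le' fun m ⟨f, hf, hd⟩ => ?_
  refine card_le_degree_of_internallyDisjoint (f := fun i => (f i).reverse) huv.symm ?_ ?_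
  · intro i j hij
    refine hf (Subtype.ext (Walk.reverse_injective ?_))
    simpa using congrArg Subtype.val hij
  · intro i j hij w hi hj
    refine (hd i j hij w ?_ ?_).symm
    · simpa using hi
    · simpa using hj

/-- The two arcs of a cycle are internally disjoint paths. -/
lemma Walk.IsCycle.two_le_maxDisjointPaths [Fintype (G.neighborSet u)] {c : G.Walk u u}
    (hc : c.IsCycle) (hv : v ∈ c.support) (huv : u ≠ v) : 2 ≤ maxDisjointPaths G u v := by
  classical
  set p := c.takeUntil v hv
  set q := c.dropUntil v hv
  have hspec : p.append q = c := c.take_spec hv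
  have hpp : p.IsPath := hc.isPath_takeUntil hv
  have hqp : q.IsPath := by
    have h := hspec ▸ hc
    exact h.isPath_of_append_right (Walk.not_nil_of_ne huv)
  have hdisj : List.Disjoint p.support.tail q.support.tail := by
    have h := hc.support_nodup
    rw [← hspec, Walk.tail_support_append] at h
    exact List.disjoint_of_nodup_append h
  have hint : InternallyDisjoint p q.reverse := by
    intro w hwp hwq
    rw [Walk.support_reverse, List.mem_reverse] at hwq
    rw [Walk.mem_support_iff] at hwp hwq
    rcases hwp with rfl | hwp
    · exact .inl rfl
    rcases hwq with rfl | hwq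
    · exact .inr rfl
    exact (hdisj hwp hwq).elim
  have hne : p ≠ q.reverse := by
    intro h
    have hlen : p.length = 1 := by
      refine hpp.length_eq_one_of_snd_eq huv ?_
      refine (hint _ (Walk.getVert_mem_support _ _) ?_).resolve_left ?_
      · rw [← h]
        exact Walk.getVert_mem_support _ _
      · exact (Walk.adj_snd (Walk.not_nil_of_ne huv)).ne'
    have hlen' : q.length = 1 := by rw [← Walk.length_reverse, ← h, hlen]
    have := hc.three_le_length
    rw [← hspec, Walk.length_append] at this
    omega
  refine le_csSup ⟨G.degree u, fun m ⟨f, hf, hd⟩ =>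
    card_le_degree_of_internallyDisjoint huv hf hd⟩ ?_
  refine ⟨![⟨p, hpp⟩, ⟨q.reverse, hqp.reverse⟩], ?_, ?_⟩
  · intro i j hij
    fin_cases i <;> fin_cases j <;> simp_all [Subtype.ext_iff]
  · intro i j hij
    fin_cases i <;> fin_cases j
    · exact (hij rfl).elim
    · exact hint
    · exact fun w h₁ h₂ => hint w h₂ h₁
    · exact (hij rfl).elim

/-- A connected 2-regular finite graph has a Hamiltonian cycle. -/
lemma Connected.exists_isHamiltonianCycle [Fintype V] [DecidableEq V] [DecidableRel G.Adj]
    (hG : G.Connected) (hdeg : G.IsRegularOfDegree 2) (u : V) :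
    ∃ c : G.Walk u u, c.IsHamiltonianCycle := by
  have hncard (w : V) : (G.neighborSet w).ncard = 2 := by
    rw [Set.ncard_eq_toFinset_card', ← hdeg w]
    rfl
  have hcyc : G.IsCycles := fun w _ => hncard w
  obtain ⟨c, hc, hverts⟩ := hcyc.exists_cycle_toSubgraph_verts_eq_connectedComponentSupp
    (c := G.connectedComponentMk u) (v := u) rfl
    (Set.nonempty_of_ncard_ne_zero (by rw [hncard]; decide))
  refine ⟨c, Walk.isHamiltonianCycle_isCycle_and_isHamiltonian_tail.mpr
    ⟨hc, hc.isPath_tail.isHamiltonian_of_mem fun w => ?_⟩⟩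
  have hw : w ∈ c.support := by
    rw [← Walk.mem_verts_toSubgraph, hverts, ConnectedComponent.mem_supp_iff,
      ConnectedComponent.eq]
    exact hG.preconnected w u
  rw [Walk.support_tail_of_not_nil _ hc.not_nil]
  rcases Walk.mem_support_iff _ |>.mp hw with rfl | h
  · exact c.end_mem_tail_support hc.not_nil
  · exact h

/-- An injective homomorphism between finite regular graphs of the same degree and order
is an isomorphism. -/
lemma nonempty_iso_of_isContained {W : Type*} [Fintype V] [Fintype W] {H : SimpleGraph W}
    [DecidableRel G.Adj] [DecidableRel H.Adj] {d : ℕ} (hG : G.IsRegularOfDegree d)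
    (hH : H.IsRegularOfDegree d) (hcard : Fintype.card V = Fintype.card W) (h : G ⊑ H) :
    Nonempty (G ≃g H) := by
  classical
  obtain ⟨f⟩ := h
  have hbij : Function.Bijective f.toHom :=
    (Fintype.bijective_iff_injective_and_card _).mpr ⟨f.injective, hcard⟩
  refine ⟨Equiv.ofBijective _ hbij, fun {a b} => ⟨fun hab => ?_, fun hab => f.toHom.map_adj hab⟩⟩
  have himg : (G.neighborFinset a).image f.toHom = H.neighborFinset (f.toHom a) := by
    refine Finset.eq_of_subset_of_card_le ?_ ?_
    · intro w hw
      obtain ⟨x, hx, rfl⟩ := Finset.mem_image.mp hw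
      rw [mem_neighborFinset] at hx ⊢
      exact f.toHom.map_adj hx
    · rw [Finset.card_image_of_injective _ hbij.injective, card_neighborFinset_eq_degree,
        card_neighborFinset_eq_degree, hG a, hH]
  have hb : f.toHom b ∈ (G.neighborFinset a).image f.toHom := by
    rw [himg, mem_neighborFinset]
    exact hab
  obtain ⟨x, hx, hxb⟩ := Finset.mem_image.mp hb
  rw [← hbij.injective hxb]
  exact (mem_neighborFinset _ _ _).mp hx

lemma isRegularOfDegree_cycleGraph {n : ℕ} (hn : 3 ≤ n) [DecidableRel (cycleGraph n).Adj] :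
    (cycleGraph n).IsRegularOfDegree 2 := by
  obtain ⟨k, rfl⟩ := Nat.exists_eq_add_of_le' hn
  intro v
  convert cycleGraph_degree_three_le (n := k) (v := v)

lemma Connected.nonempty_iso_cycleGraph [Fintype V] [DecidableRel G.Adj] (hG : G.Connected)
    (hdeg : G.IsRegularOfDegree 2) {n : ℕ} (hn : Fintype.card V = n) :
    Nonempty (G ≃g cycleGraph n) := by
  classical
  subst hn
  obtain ⟨u⟩ := hG.nonempty
  obtain ⟨c, hc⟩ := hG.exists_isHamiltonianCycle hdeg u
  have hthree : 3 ≤ Fintype.card V := hc.length_eq ▸ hc.isCycle.three_le_length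
  have hcont : cycleGraph (Fintype.card V) ⊑ G :=
    (cycleGraph_isContained_iff hthree).mpr ⟨u, c, hc.isCycle, hc.length_eq⟩
  obtain ⟨e⟩ := nonempty_iso_of_isContained (isRegularOfDegree_cycleGraph hthree) hdeg
    (by simp) hcont
  exact ⟨e.symm⟩

end SimpleGraph

lemma Nat.cast_min_eq_sum_indicator {a b N : ℕ} (ha : a ≤ N) :
    ((min a b : ℕ) : ℝ) = ∑ k ∈ Finset.range N, if k < a ∧ k < b then (1 : ℝ) else 0 := by
  have hfilter : (Finset.range N).filter (fun k => k < a ∧ k < b) = Finset.range (min a b) := by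
    ext k
    simp only [Finset.mem_filter, Finset.mem_range]
    omega
  rw [← Finset.sum_filter, hfilter]
  simp

lemma sum_sum_offDiag_mul {ι : Type*} [Fintype ι] [DecidableEq ι] (z : ι → ℝ) :
    ∑ i, ∑ j, (if i = j then 0 else z i * z j) = (∑ i, z i) ^ 2 - ∑ i, z i ^ 2 := by
  rw [sq, Finset.sum_mul_sum, ← Finset.sum_sub_distrib]
  refine Finset.sum_congr rfl fun i _ => ?_
  have hdiag : z i ^ 2 = ∑ j, if i = j then z i * z j else 0 := by simp [sq]
  rw [hdiag, ← Finset.sum_sub_distrib]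
  refine Finset.sum_congr rfl fun j _ => ?_
  split_ifs <;> ring

lemma sum_sum_offDiag_indicator_mul_le {ι : Type*} [Fintype ι] [DecidableEq ι] {S : Finset ι}
    (hS : S.Nonempty) (y : ι → ℝ) :
    ∑ i, ∑ j, (if i = j then 0 else (if i ∈ S then y i else 0) * (if j ∈ S then y j else 0)) ≤
      ((S.card : ℝ) - 1) * ∑ i, y i ^ 2 := by
  rw [sum_sum_offDiag_mul fun i => if i ∈ S then y i else 0]
  have hsq : ∑ i, (if i ∈ S then y i else 0) ^ 2 = ∑ i ∈ S, y i ^ 2 := by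
    simp [ite_pow]
  have hcs : (∑ i ∈ S, y i) ^ 2 ≤ S.card * ∑ i ∈ S, y i ^ 2 := sq_sum_le_card_mul_sum_sq
  have hle : ∑ i ∈ S, y i ^ 2 ≤ ∑ i, y i ^ 2 :=
    Finset.sum_le_sum_of_subset_of_nonneg (Finset.subset_univ S) fun i _ _ => sq_nonneg _
  have hcard : (1 : ℝ) ≤ S.card := by exact_mod_cast hS.card_pos
  rw [hsq]
  simp only [Finset.sum_ite_mem, Finset.univ_inter]
  nlinarith [mul_le_mul_of_nonneg_left hle (sub_nonneg.mpr hcard)]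

/-- If a matrix with zero diagonal is dominated entrywise by `min (d i) (d j)`, then its quadratic
form is bounded by `∑ d - max d`. -/
lemma Matrix.quadraticForm_le_of_le_min {ι : Type*} [Fintype ι] [DecidableEq ι]
    {M : Matrix ι ι ℝ} {d : ι → ℕ} {i₀ : ι} (hmax : ∀ i, d i ≤ d i₀) (hdiag : ∀ i, M i i = 0)
    (hnonneg : ∀ i j, 0 ≤ M i j) (hle : ∀ i j, i ≠ j → M i j ≤ (min (d i) (d j) : ℕ))
    (x : ι → ℝ) :
    ∑ i, ∑ j, x i * (M i j * x j) ≤ (∑ i, (d i : ℝ) - d i₀) * ∑ i, x i ^ 2 := by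
  set S : ℕ → Finset ι := fun k => Finset.univ.filter fun i => k < d i with hS
  have hentry (i j : ι) : x i * (M i j * x j) ≤ ∑ k ∈ Finset.range (d i₀),
      if i = j then 0 else
        (if i ∈ S k then |x i| else 0) * (if j ∈ S k then |x j| else 0) := by
    by_cases hij : i = j
    · subst hij
      simp [hdiag]
    calc x i * (M i j * x j) ≤ |x i * (M i j * x j)| := le_abs_self _
      _ = M i j * (|x i| * |x j|) := by
        rw [abs_mul, abs_mul, abs_of_nonneg (hnonneg i j)]
        ring
      _ ≤ (min (d i) (d j) : ℕ) * (|x i| * |x j|) := by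
        gcongr
        exact hle i j hij
      _ = _ := by
        rw [Nat.cast_min_eq_sum_indicator (hmax i), Finset.sum_mul]
        refine Finset.sum_congr rfl fun k _ => ?_
        by_cases hi : k < d i <;> by_cases hj : k < d j <;> simp [hS, hij, hi, hj]
  have hlevel (k : ℕ) (hk : k ∈ Finset.range (d i₀)) :=
    sum_sum_offDiag_indicator_mul_le (S := S k)
      ⟨i₀, by simpa [hS] using hk⟩ (fun i => |x i|)
  have hcard : ∑ k ∈ Finset.range (d i₀), ((S k).card : ℝ) = ∑ i, (d i : ℝ) := by
    have hrow (i : ι) : (d i : ℝ) = ∑ k ∈ Finset.range (d i₀), if k < d i then (1 : ℝ) else 0 := by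
      simpa using Nat.cast_min_eq_sum_indicator (b := d i) (hmax i)
    simp_rw [hrow]
    rw [Finset.sum_comm]
    simp [hS]
  calc ∑ i, ∑ j, x i * (M i j * x j)
      ≤ ∑ i, ∑ j, ∑ k ∈ Finset.range (d i₀), if i = j then 0 else
          (if i ∈ S k then |x i| else 0) * (if j ∈ S k then |x j| else 0) :=
        Finset.sum_le_sum fun i _ => Finset.sum_le_sum fun j _ => hentry i j
    _ = ∑ k ∈ Finset.range (d i₀), ∑ i, ∑ j, if i = j then 0 else
          (if i ∈ S k then |x i| else 0) * (if j ∈ S k then |x j| else 0) := by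
        simp_rw [Finset.sum_comm (s := Finset.univ) (t := Finset.range (d i₀))]
    _ ≤ ∑ k ∈ Finset.range (d i₀), (((S k).card : ℝ) - 1) * ∑ i, |x i| ^ 2 :=
        Finset.sum_le_sum hlevel
    _ = (∑ i, (d i : ℝ) - d i₀) * ∑ i, x i ^ 2 := by
        rw [← Finset.sum_mul, Finset.sum_sub_distrib, hcard]
        simp

lemma Matrix.isRoot_charpoly_iff_exists_mulVec_eq_s15 {ι : Type*} [Fintype ι] [DecidableEq ι]
    {M : Matrix ι ι ℝ} {μ : ℝ} : M.charpoly.IsRoot μ ↔ ∃ x : ι → ℝ, x ≠ 0 ∧ M.mulVec x = μ • x := by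
  rw [← Matrix.charpoly_toLin', ← Module.End.hasEigenvalue_iff_isRoot_charpoly]
  constructor
  · intro h
    obtain ⟨x, hx⟩ := h.exists_hasEigenvector
    exact ⟨x, hx.2, by simpa using hx.apply_eq_smul⟩
  · rintro ⟨x, hx, hμ⟩
    exact Module.End.hasEigenvalue_of_hasEigenvector
      (Module.End.hasEigenvector_iff.mpr ⟨Module.End.mem_eigenspace_iff.mpr (by simpa using hμ), hx⟩)

lemma Matrix.isRoot_charpoly_le_of_le_min {ι : Type*} [Fintype ι] [DecidableEq ι]
    {M : Matrix ι ι ℝ} {d : ι → ℕ} {i₀ : ι} (hmax : ∀ i, d i ≤ d i₀) (hdiag : ∀ i, M i i = 0)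
    (hnonneg : ∀ i j, 0 ≤ M i j) (hle : ∀ i j, i ≠ j → M i j ≤ (min (d i) (d j) : ℕ))
    {μ : ℝ} (hμ : M.charpoly.IsRoot μ) : μ ≤ ∑ i, (d i : ℝ) - d i₀ := by
  obtain ⟨x, hx, hμx⟩ := Matrix.isRoot_charpoly_iff_exists_mulVec_eq_s15.mp hμ
  have hform : ∑ i, ∑ j, x i * (M i j * x j) = μ * ∑ i, x i ^ 2 := by
    rw [Finset.mul_sum]
    refine Finset.sum_congr rfl fun i _ => ?_
    have h : ∑ j, M i j * x j = μ * x i := congrFun hμx i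
    rw [← Finset.mul_sum, h]
    ring
  have hpos : 0 < ∑ i, x i ^ 2 := by
    obtain ⟨i, hi⟩ := Function.ne_iff.mp hx
    exact Finset.sum_pos' (fun j _ => sq_nonneg _) ⟨i, Finset.mem_univ i, sq_pos_of_ne_zero hi⟩
  exact le_of_mul_le_mul_right
    (hform ▸ Matrix.quadraticForm_le_of_le_min hmax hdiag hnonneg hle x) hpos

section PathMatrix

variable {n : ℕ} {G : SimpleGraph (Fin n)}

lemma pathMatrix_nonneg (i j : Fin n) : 0 ≤ pathMatrix G i j := by
  by_cases h : i = j
  · rw [h, pathMatrix_apply_self]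
  · rw [pathMatrix_apply_of_ne h]
    positivity

lemma isRoot_charpoly_pathMatrix_le [DecidableRel G.Adj] {i₀ : Fin n}
    (hmax : ∀ i, G.degree i ≤ G.degree i₀) {μ : ℝ} (hμ : (pathMatrix G).charpoly.IsRoot μ) :
    μ ≤ ∑ i, (G.degree i : ℝ) - G.degree i₀ := by
  refine Matrix.isRoot_charpoly_le_of_le_min hmax pathMatrix_apply_self pathMatrix_nonneg
    (fun i j hij => ?_) hμ
  rw [pathMatrix_apply_of_ne hij, Nat.cast_le]
  exact le_min (maxDisjointPaths_le_degree_left hij) (maxDisjointPaths_le_degree_right hij)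

lemma isRoot_charpoly_pathMatrix_of_isRegularOfDegree_two [NeZero n] [DecidableRel G.Adj]
    (hG : G.Connected) (hdeg : G.IsRegularOfDegree 2) :
    (pathMatrix G).charpoly.IsRoot (2 * ((n : ℝ) - 1)) := by
  refine Matrix.isRoot_charpoly_iff_exists_mulVec_eq_s15.mpr ⟨1, one_ne_zero, ?_⟩
  have hentry (i j : Fin n) : pathMatrix G i j = 2 - if i = j then 2 else 0 := by
    by_cases hij : i = j
    · simp [hij, pathMatrix_apply_self]
    · obtain ⟨c, hc⟩ := hG.exists_isHamiltonianCycle hdeg i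
      have hge := hc.isCycle.two_le_maxDisjointPaths (hc.mem_support j) hij
      have hle := (maxDisjointPaths_le_degree_left hij).trans_eq (hdeg i)
      rw [pathMatrix_apply_of_ne hij, le_antisymm hle hge]
      simp [hij]
  ext i
  simp only [Matrix.mulVec, dotProduct, hentry, Pi.one_apply, mul_one, Finset.sum_sub_distrib,
    Finset.sum_ite_eq, Finset.mem_univ, if_true, Finset.sum_const, Finset.card_univ,
    Fintype.card_fin, nsmul_eq_mul, Pi.smul_apply, smul_eq_mul]
  ring

end PathMatrix

/-- for a unicyclic graph on n ≥ 4 vertices,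
ρ(G) ≤ 2(n − 1) < (n − 1)², with equality exactly for the cycle C_n. -/
theorem pathSpectralRadius_unicyclic_max {n : ℕ} (hn : 4 ≤ n)
    (G : SimpleGraph (Fin n)) (hG : G.Connected)
    (hedges : Nat.card G.edgeSet = n) :
    pathSpectralRadius G ≤ 2 * ((n : ℝ) - 1) ∧
      2 * ((n : ℝ) - 1) < ((n : ℝ) - 1) ^ 2 ∧
      (pathSpectralRadius G = 2 * ((n : ℝ) - 1) ↔
        Nonempty (G ≃g cycleGraph n)) := by
  classical
  have hn4 : (4 : ℝ) ≤ n := by exact_mod_cast hn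
  have : NeZero n := ⟨by omega⟩
  have hsum : ∑ i, G.degree i = 2 * n := by
    rw [G.sum_degrees_eq_twice_card_edges, G.edgeFinset_card, ← Nat.card_eq_fintype_card, hedges]
  have hsumR : ∑ i, (G.degree i : ℝ) = 2 * n := by exact_mod_cast hsum
  obtain ⟨i₀, hi₀⟩ := Finite.exists_max fun i => G.degree i
  have hroot (μ : ℝ) (hμ : (pathMatrix G).charpoly.IsRoot μ) : μ ≤ 2 * n - G.degree i₀ :=
    hsumR ▸ isRoot_charpoly_pathMatrix_le hi₀ hμ
  have hi₀n : (G.degree i₀ : ℝ) ≤ n := by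
    exact_mod_cast (G.degree_lt_card_verts i₀).le.trans_eq (Fintype.card_fin n)
  have hρ : pathSpectralRadius G ≤ 2 * n - G.degree i₀ :=
    Real.sSup_le hroot (by linarith)
  have htwo : 2 ≤ G.degree i₀ := by
    by_contra! h
    have hle : ∑ i, G.degree i ≤ ∑ _i : Fin n, 1 :=
      Finset.sum_le_sum fun i _ => (hi₀ i).trans (by omega)
    simp only [Finset.sum_const, Finset.card_univ, Fintype.card_fin, smul_eq_mul] at hle
    omega
  have htwoR : (2 : ℝ) ≤ G.degree i₀ := by exact_mod_cast htwo
  refine ⟨by linarith, by nlinarith, fun heq => ?_, fun ⟨e⟩ => ?_⟩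
  · have hdeg : G.degree i₀ ≤ 2 := by
      have : (G.degree i₀ : ℝ) ≤ 2 := by linarith
      exact_mod_cast this
    have hreg : G.IsRegularOfDegree 2 := by
      have hle (i : Fin n) (_ : i ∈ Finset.univ) : G.degree i ≤ 2 := (hi₀ i).trans hdeg
      have hall := (Finset.sum_eq_sum_iff_of_le hle).mp (by simp [hsum, mul_comm])
      exact fun i => hall i (Finset.mem_univ i)
    exact hG.nonempty_iso_cycleGraph hreg (Fintype.card_fin n)
  · have hreg : G.IsRegularOfDegree 2 := fun v => by
      rw [← e.degree_eq v]
      exact isRegularOfDegree_cycleGraph (by omega) (e v)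
    refine le_antisymm (by linarith) (le_csSup ⟨_, hroot⟩ ?_)
    exact isRoot_charpoly_pathMatrix_of_isRegularOfDegree_two hG hreg
end
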